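/- arXiv:1804.10513 — 11 statements merged into one kernel-verified Lean document; each statement's English description precedes it below -/
import Mathlib

section
/- Let G be a finite group and let x ∈ G be a real element. If the size of the conjugacy class of x in G is odd, then x^2 = 1. -/
/-- If `x` is a real element of a finite group `G` whose conjugacy class has odd size,
then `x ^ 2 = 1`. -/
theorem stmt_5 {G : Type*} [Group G] [Finite G] (x : G) (hx : IsConj x x⁻¹)
    (hodd : Odd (Nat.card (conjugatesOf x))) : x ^ 2 = 1 := by
  classical
  have := Fintype.ofFinite (conjugatesOf x)
  have hinv : ∀ y ∈ conjugatesOf x, y⁻¹ ∈ conjugatesOf x := by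
    intro y hy
    obtain ⟨c, rfl⟩ := isConj_iff.1 (show IsConj x y from hy)
    refine hx.trans (isConj_iff.2 ⟨c, ?_⟩)
    group
  let f : conjugatesOf x → conjugatesOf x := fun y => ⟨(y : G)⁻¹, hinv y y.2⟩
  have hf : Function.Involutive f := fun y => Subtype.ext (inv_inv (y : G))
  have hcard : ¬ 2 ∣ Fintype.card (conjugatesOf x) := by
    rw [← Nat.card_eq_fintype_card]
    exact hodd.not_two_dvd_nat
  obtain ⟨⟨y, hy⟩, hfix⟩ := Equiv.Perm.exists_fixed_point_of_prime (p := 2) (n := 1) hcard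
    (σ := hf.toPerm) (by ext z; simp [pow_two, hf z])
  have hyinv : y⁻¹ = y := congrArg Subtype.val hfix
  have hysq : y ^ 2 = 1 := by rw [pow_two, mul_eq_one_iff_inv_eq, hyinv]
  obtain ⟨c, rfl⟩ := isConj_iff.1 (show IsConj x y from hy)
  rwa [conj_pow, conj_eq_one_iff] at hysq
end

section
/- Let G be a finite group and let N be a normal subgroup of G of odd index. Then the set of real elements of G equals the set of real elements of N; that is, every real element of G lies in N and is conjugate in N to its inverse, and conversely every real element of N is a real element of G. -/
theorem SemiconjBy.pow_left_of_odd {G : Type*} [Group G] {g x : G} (h : SemiconjBy g x x⁻¹)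
    {m : ℕ} (hm : Odd m) : SemiconjBy (g ^ m) x x⁻¹ := by
  obtain ⟨k, rfl⟩ := hm
  have h' : SemiconjBy g x⁻¹ x := by simpa using h.inv_right
  have hcomm : Commute (g ^ 2) x := by
    rw [pow_two]
    exact h'.mul_left h
  rw [pow_succ, pow_mul]
  exact SemiconjBy.mul_left (hcomm.inv_right.pow_left k) h

theorem Subgroup.mem_of_sq_mem_of_odd_index {G : Type*} [Group G] {N : Subgroup G} [N.Normal]
    (hodd : Odd N.index) {x : G} (hx : x ^ 2 ∈ N) : x ∈ N := by
  have hpow : x ^ N.index ∈ N := N.pow_index_mem x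
  obtain ⟨k, hk⟩ := hodd
  rw [hk, pow_succ, pow_mul] at hpow
  exact (N.mul_mem_cancel_left (N.pow_mem hx k)).mp hpow

/-- If `N` is a normal subgroup of odd index of a finite group `G`, then the real
elements of `G` are exactly the real elements of `N`. -/
theorem stmt_7 {G : Type*} [Group G] [Finite G] (N : Subgroup G) [N.Normal]
    (hodd : Odd N.index) :
    ∀ x : G, IsConj x x⁻¹ ↔ ∃ hx : x ∈ N, IsConj (⟨x, hx⟩ : N) (⟨x, hx⟩ : N)⁻¹ := by
  intro x
  constructor
  · rintro ⟨g, hg⟩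
    have hconj : SemiconjBy ((g : G) ^ N.index) x x⁻¹ := hg.pow_left_of_odd hodd
    set c : G := (g : G) ^ N.index
    have hc : c ∈ N := N.pow_index_mem _
    have hsq : x ^ 2 = x * c⁻¹ * x⁻¹ * c := by
      rw [mul_assoc, ← hconj.eq]
      simp [pow_two, mul_assoc]
    have hx : x ∈ N := by
      refine Subgroup.mem_of_sq_mem_of_odd_index hodd ?_
      rw [hsq]
      exact N.mul_mem (Subgroup.Normal.conj_mem inferInstance _ (N.inv_mem hc) x) hc
    refine ⟨hx, isConj_iff.mpr ⟨⟨c, hc⟩, Subtype.ext ?_⟩⟩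
    simp [hconj.eq]
  · rintro ⟨hx, h⟩
    simpa using N.subtype.map_isConj h
end

section
/- A finite group G has no nontrivial real element of odd order if and only if G has a normal Sylow 2-subgroup. -/
/-- If `a` and `b` are congruent modulo a finite normal subgroup `N` and have `q`-th power `1` for
a prime `q` not dividing the order of `N`, then they are conjugate by an element of `N`. -/
theorem exists_mul_eq_mul_of_pow_prime_eq_one {G : Type*} [Group G] {N : Subgroup G} [N.Normal]
    [Finite N] {q : ℕ} [hq : Fact q.Prime] (hN : ¬ q ∣ Nat.card N) {a b : G} (ha : a ^ q = 1)
    (hb : b ^ q = 1) (hab : b * a⁻¹ ∈ N) : ∃ n ∈ N, b * n = n * a := by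
  classical
  have := Fintype.ofFinite N
  have hba : b⁻¹ * a ∈ N := by
    have := N.inv_mem (Subgroup.Normal.conj_mem ‹_› _ hab b⁻¹)
    simpa [mul_assoc] using this
  let σ : Equiv.Perm N :=
    { toFun n := ⟨b * n * a⁻¹, by
        have := N.mul_mem (Subgroup.Normal.conj_mem ‹_› _ n.2 b) hab
        simpa [mul_assoc] using this⟩
      invFun n := ⟨b⁻¹ * n * a, by
        have := N.mul_mem (Subgroup.Normal.conj_mem ‹_› _ n.2 b⁻¹) hba
        simpa [mul_assoc] using this⟩
      left_inv n := by ext; simp [mul_assoc]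
      right_inv n := by ext; simp [mul_assoc] }
  have hσ (k : ℕ) (n : N) : ((σ ^ k) n : G) = b ^ k * n * (a ^ k)⁻¹ := by
    induction k with
    | zero => simp
    | succ k ih =>
      rw [pow_succ', Equiv.Perm.mul_apply]
      change b * ((σ ^ k) n : G) * a⁻¹ = _
      rw [ih, pow_succ' b, pow_succ a]
      group
  obtain ⟨n, hn⟩ := Equiv.Perm.exists_fixed_point_of_prime (p := q) (n := 1) (σ := σ)
    (by rwa [← Nat.card_eq_fintype_card]) (by ext n; simp [hσ, ha, hb])
  refine ⟨n, n.2, ?_⟩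
  have := congrArg (Subtype.val) hn
  change b * (n : G) * a⁻¹ = n at this
  rwa [mul_inv_eq_iff_eq_mul] at this

/-- If a `p`-subgroup `P` contains an element of a conjugation-invariant set `C` outside a
subgroup `D ≤ P`, then such an element can be chosen so that it conjugates `C ∩ D` into itself. -/
theorem IsPGroup.exists_mem_notMem_conj_mem {G : Type*} [Group G] [Finite G] {p : ℕ}
    [Fact p.Prime] {C : Set G} (hC : ∀ g, ∀ x ∈ C, g * x * g⁻¹ ∈ C) {P D : Subgroup G}
    (hP : IsPGroup p P) (hDP : D ≤ P) {c : G} (hcC : c ∈ C) (hcP : c ∈ P) (hcD : c ∉ D) :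
    ∃ x ∈ C, x ∈ P ∧ x ∉ D ∧ ∀ d ∈ C, d ∈ D → x * d * x⁻¹ ∈ D := by
  have := hP.isNilpotent
  have hnc : NormalizerCondition P := Group.normalizerCondition_of_isNilpotent
  let s : Set (Subgroup P) := {M | D.subgroupOf P ≤ M ∧ ∀ m ∈ M, (m : G) ∈ C → (m : G) ∈ D}
  obtain ⟨M, hM⟩ := s.toFinite.exists_maximal ⟨D.subgroupOf P, le_rfl, fun m hm _ ↦ hm⟩
  have hlt := hnc M <| lt_top_iff_ne_top.2 fun h ↦
    hcD (hM.1.2 ⟨c, hcP⟩ (h ▸ Subgroup.mem_top _) hcC)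
  have hnot : ¬ ∀ m ∈ Subgroup.normalizer (M : Set P), (m : G) ∈ C → (m : G) ∈ D := fun h ↦
    hlt.not_ge (hM.2 ⟨hM.1.1.trans hlt.le, h⟩ hlt.le)
  push Not at hnot
  obtain ⟨x, hxM, hxC, hxD⟩ := hnot
  refine ⟨x, hxC, x.2, hxD, fun d hdC hdD ↦ ?_⟩
  have hdM : (⟨d, hDP hdD⟩ : P) ∈ M := hM.1.1 hdD
  exact hM.1.2 _ ((Subgroup.mem_normalizer_iff.1 hxM _).1 hdM) (hC _ _ hdC)

/-- The **Baer–Suzuki theorem**: a conjugation-invariant set whose elements pairwise generate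
`p`-groups generates a `p`-group. -/
theorem isPGroup_closure_of_pairwise {G : Type*} [Group G] [Finite G] {p : ℕ} [Fact p.Prime]
    {C : Set G} (hC : ∀ g, ∀ x ∈ C, g * x * g⁻¹ ∈ C)
    (h : ∀ x ∈ C, ∀ y ∈ C, IsPGroup p (Subgroup.closure {x, y})) :
    IsPGroup p (Subgroup.closure C) := by
  by_contra hne
  have hex : ∃ PQ : Sylow p G × Sylow p G, C ∩ PQ.1 ≠ C ∩ PQ.2 := by
    by_contra! hall
    let P : Sylow p G := default
    refine hne (P.2.to_le ((Subgroup.closure_le _).2 fun x hx ↦ ?_))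
    obtain ⟨Q, hQ⟩ := (h x hx x hx).exists_le_sylow
    have hxQ : x ∈ C ∩ Q := ⟨hx, hQ (Subgroup.subset_closure (by simp))⟩
    rw [← hall (P, Q)] at hxQ
    exact hxQ.2
  obtain ⟨⟨P, Q⟩, hPQ, hmax⟩ := Set.exists_max_image
    {PQ : Sylow p G × Sylow p G | C ∩ PQ.1 ≠ C ∩ PQ.2}
    (fun PQ ↦ (C ∩ ((PQ.1 : Subgroup G) ⊓ PQ.2 : Subgroup G)).ncard) (Set.toFinite _) hex
  have key (P Q : Sylow p G) (hne : C ∩ P ≠ C ∩ Q) :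
      ∃ x ∈ C, x ∈ P ∧ x ∉ (P : Subgroup G) ⊓ Q ∧
        ∀ d ∈ C, d ∈ (P : Subgroup G) ⊓ Q → x * d * x⁻¹ ∈ (P : Subgroup G) ⊓ Q := by
    obtain ⟨g, rfl⟩ := MulAction.exists_smul_eq G P Q
    have hcard : (C ∩ P).ncard = (C ∩ (g • P : Sylow p G)).ncard := by
      rw [← Set.ncard_image_of_injective (C ∩ P) (MulAut.conj g).injective]
      congr 1
      ext y
      simp only [Set.mem_image, Set.mem_inter_iff, SetLike.mem_coe, MulAut.conj_apply]
      constructor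
      · rintro ⟨x, ⟨hxC, hxP⟩, rfl⟩
        exact ⟨hC _ _ hxC, ⟨x, hxP, rfl⟩⟩
      · rintro ⟨hyC, x, hxP, rfl⟩
        refine ⟨x, ⟨?_, hxP⟩, rfl⟩
        simpa [mul_assoc] using hC g⁻¹ _ hyC
    have hnot : ¬ C ∩ P ⊆ C ∩ (g • P : Sylow p G) := fun hle ↦
      hne (Set.eq_of_subset_of_ncard_le hle hcard.ge)
    obtain ⟨c, ⟨hcC, hcP⟩, hc⟩ := Set.not_subset.1 hnot
    exact P.2.exists_mem_notMem_conj_mem hC inf_le_left hcC hcP fun hcD ↦ hc ⟨hcC, hcD.2⟩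
  let S : Set G := C ∩ ((P : Subgroup G) ⊓ Q : Subgroup G)
  have hnorm {x : G}
      (hx : ∀ d ∈ C, d ∈ (P : Subgroup G) ⊓ Q → x * d * x⁻¹ ∈ (P : Subgroup G) ⊓ Q) :
      x ∈ Subgroup.normalizer (Subgroup.closure S : Set G) := by
    refine Subgroup.mem_normalizer_iff_map_conj_eq.2 ?_
    rw [MonoidHom.map_closure]
    congr 1
    refine Set.eq_of_subset_of_ncard_le ?_ ?_
    · rintro _ ⟨d, hd, rfl⟩
      exact ⟨hC _ _ hd.1, hx d hd.1 hd.2⟩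
    · exact (Set.ncard_image_of_injective S (MulAut.conj x).injective).ge
  obtain ⟨x, hxC, hxP, hxD, hx⟩ := key P Q hPQ
  obtain ⟨y, hyC, hyQ, hyD, hy⟩ := key Q P (Ne.symm hPQ)
  rw [inf_comm] at hyD hy
  have hDp : IsPGroup p (Subgroup.closure S) :=
    P.2.to_le ((Subgroup.closure_le _).2 fun d hd ↦ hd.2.1)
  have hle : Subgroup.closure {x, y} ≤ Subgroup.normalizer (Subgroup.closure S : Set G) :=
    (Subgroup.closure_le _).2 (Set.insert_subset (hnorm hx) (Set.singleton_subset_iff.2 (hnorm hy)))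
  obtain ⟨R, hR⟩ := ((h x hxC y hyC).to_sup_of_normal_right' hDp hle).exists_le_sylow
  have hxR : x ∈ R := hR (Subgroup.mem_sup_left (Subgroup.subset_closure (by simp)))
  have hyR : y ∈ R := hR (Subgroup.mem_sup_left (Subgroup.subset_closure (by simp)))
  have hSR : S ⊆ R := fun d hd ↦ hR (Subgroup.mem_sup_right (Subgroup.subset_closure hd))
  have hstep {T : Sylow p G} {z : G} (hST : S ⊆ T) (hzC : z ∈ C) (hzT : z ∈ T) (hzR : z ∈ R)
      (hzD : z ∉ (P : Subgroup G) ⊓ Q) : C ∩ T = C ∩ R := by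
    by_contra hne
    refine (hmax (T, R) hne).not_gt (Set.ncard_lt_ncard ?_)
    have hle : S ⊆ C ∩ ((T : Subgroup G) ⊓ R : Subgroup G) :=
      fun d hd ↦ ⟨hd.1, hST hd, hSR hd⟩
    exact (Set.ssubset_iff_of_subset hle).2 ⟨z, ⟨hzC, hzT, hzR⟩, fun hz ↦ hzD hz.2⟩
  exact hPQ ((hstep (fun d hd ↦ hd.2.1) hxC hxP hxR hxD).trans
    (hstep (fun d hd ↦ hd.2.2) hyC hyQ hyR hyD).symm)

/-- The property of having no nontrivial real element of odd order passes to the quotient by a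
normal `2`-subgroup. -/
theorem eq_one_of_isConj_inv_of_odd_quotient {G : Type*} [Group G] [Finite G]
    (hG : ∀ x : G, IsConj x x⁻¹ → Odd (orderOf x) → x = 1) {N : Subgroup G} [N.Normal]
    (hN : IsPGroup 2 N) (x : G ⧸ N) (hx : IsConj x x⁻¹) (hodd : Odd (orderOf x)) : x = 1 := by
  by_contra hne
  obtain ⟨q, hq, hqx⟩ := Nat.exists_prime_and_dvd (mt orderOf_eq_one_iff.1 hne)
  have : Fact q.Prime := ⟨hq⟩
  have hq_odd : Odd q := hodd.of_dvd_nat hqx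
  have hconj_pow (k : ℕ) : IsConj (x ^ k) (x ^ k)⁻¹ := by
    obtain ⟨c, hc⟩ := isConj_iff.1 hx
    exact isConj_iff.2 ⟨c, by rw [← conj_pow, hc, inv_pow]⟩
  have hy : orderOf (x ^ (orderOf x / q)) = q := orderOf_pow_orderOf_div (orderOf_pos x).ne' hqx
  obtain ⟨z, hz⟩ := QuotientGroup.mk_surjective (x ^ (orderOf x / q))
  have hzq : z ^ q ∈ N := by
    rw [← QuotientGroup.eq_one_iff, QuotientGroup.mk_pow, hz, ← orderOf_dvd_iff_pow_eq_one, hy]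
  obtain ⟨k, hk⟩ := hN ⟨z ^ q, hzq⟩
  replace hk : (z ^ 2 ^ k) ^ q = 1 := by
    simpa [Subtype.ext_iff, ← pow_mul, mul_comm] using hk
  have hz1 : (z ^ 2 ^ k) ≠ 1 := fun h ↦ by
    have h' : (x ^ (orderOf x / q)) ^ 2 ^ k = 1 := by
      rw [← hz, ← QuotientGroup.mk_pow, h, QuotientGroup.mk_one]
    have := orderOf_dvd_of_pow_eq_one h'
    rw [hy] at this
    have := (Nat.prime_dvd_prime_iff_eq hq Nat.prime_two).1 (hq.dvd_of_dvd_pow this)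
    subst this
    exact absurd hq_odd (by decide)
  obtain ⟨c, hc⟩ := isConj_iff.1 (hconj_pow (orderOf x / q * 2 ^ k))
  obtain ⟨g, rfl⟩ := QuotientGroup.mk_surjective c
  rw [pow_mul, ← hz] at hc
  have hcard : ¬ q ∣ Nat.card N := fun hdvd ↦ by
    obtain ⟨n, hn⟩ := IsPGroup.iff_card.1 hN
    rw [hn] at hdvd
    have := (Nat.prime_dvd_prime_iff_eq hq Nat.prime_two).1 (hq.dvd_of_dvd_pow hdvd)
    subst this
    exact absurd hq_odd (by decide)
  obtain ⟨n, -, hn⟩ := exists_mul_eq_mul_of_pow_prime_eq_one (N := N) hcard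
    (a := g * (z ^ 2 ^ k) * g⁻¹) (b := (z ^ 2 ^ k)⁻¹) (by rw [conj_pow, hk]; simp)
    (by rw [inv_pow, hk, inv_one]) (by
      rw [← QuotientGroup.eq_one_iff]
      simp only [QuotientGroup.mk_mul, QuotientGroup.mk_inv, QuotientGroup.mk_pow] at hc ⊢
      rw [hc]
      simp)
  refine hz1 (hG _ (isConj_iff.2 ⟨n * g, ?_⟩) (hq_odd.of_dvd_nat (orderOf_dvd_of_pow_eq_one hk)))
  calc n * g * z ^ 2 ^ k * (n * g)⁻¹ = n * (g * z ^ 2 ^ k * g⁻¹) * n⁻¹ := by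
        simp only [mul_assoc, mul_inv_rev]
    _ = (z ^ 2 ^ k)⁻¹ := by rw [← hn, mul_inv_cancel_right]

/-- The closure of two involutions whose product has `2`-power order is a `2`-group. -/
theorem isPGroup_closure_pair_of_involutions {G : Type*} [Group G] {s t : G} (hs : s ^ 2 = 1)
    (ht : t ^ 2 = 1) {k : ℕ} (hst : (s * t) ^ 2 ^ k = 1) :
    IsPGroup 2 (Subgroup.closure {s, t}) := by
  have hzpow {g : G} {j : ℕ} (hg : g ^ 2 ^ j = 1) : IsPGroup 2 (Subgroup.zpowers g) := by
    refine IsPGroup.of_card_dvd_pow (n := j) ?_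
    rw [Nat.card_zpowers]
    exact orderOf_dvd_of_pow_eq_one hg
  have hs' : s⁻¹ = s := inv_eq_of_mul_eq_one_left (by rw [← sq, hs])
  have ht' : t⁻¹ = t := inv_eq_of_mul_eq_one_left (by rw [← sq, ht])
  have hnorm : Subgroup.zpowers s ≤ Subgroup.normalizer (Subgroup.zpowers (s * t) : Set G) := by
    rw [Subgroup.zpowers_le]
    refine Subgroup.mem_normalizer_iff_map_conj_eq.2 ?_
    rw [MonoidHom.map_zpowers, ← Subgroup.zpowers_inv (g := s * t)]
    congr 1
    simp only [MonoidHom.coe_coe, MulAut.conj_apply, mul_inv_rev, hs', ht']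
    rw [← mul_assoc, ← sq, hs, one_mul]
  refine (((hzpow (j := 1) (by simpa using hs)).to_sup_of_normal_right' (hzpow hst) hnorm).to_le
    ((Subgroup.closure_le _).2 ?_))
  have hsmem : s ∈ Subgroup.zpowers s ⊔ Subgroup.zpowers (s * t) :=
    Subgroup.mem_sup_left (Subgroup.mem_zpowers s)
  refine Set.insert_subset hsmem (Set.singleton_subset_iff.2 ?_)
  simpa using mul_mem (inv_mem hsmem)
    (Subgroup.mem_sup_right (S := Subgroup.zpowers s) (Subgroup.mem_zpowers (s * t)))

/-- In a finite group without nontrivial real elements of odd order, involutions have normal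
closures that are `2`-groups. -/
theorem isPGroup_normalClosure_of_involution {G : Type*} [Group G] [Finite G]
    (hG : ∀ x : G, IsConj x x⁻¹ → Odd (orderOf x) → x = 1) {t : G} (ht : t ^ 2 = 1) :
    IsPGroup 2 (Subgroup.normalClosure {t}) := by
  have hsq {x : G} (hx : x ∈ Group.conjugatesOfSet {t}) : x ^ 2 = 1 := by
    simp only [Group.mem_conjugatesOfSet_iff, Set.mem_singleton_iff, exists_eq_left,
      isConj_iff] at hx
    obtain ⟨c, rfl⟩ := hx
    rw [conj_pow, ht, mul_one, mul_inv_cancel]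
  refine isPGroup_closure_of_pairwise (fun g x hx ↦ Group.conj_mem_conjugatesOfSet hx)
    fun x hx y hy ↦ ?_
  replace hx := hsq hx
  replace hy := hsq hy
  obtain ⟨k, m, hm, hkm⟩ := Nat.exists_eq_two_pow_mul_odd (orderOf_pos (x * y)).ne'
  refine isPGroup_closure_pair_of_involutions hx hy (k := k) (hG _ (isConj_iff.2 ⟨x, ?_⟩) ?_)
  · have hx' : x⁻¹ = x := inv_eq_of_mul_eq_one_left (by rw [← sq, hx])
    have hy' : y⁻¹ = y := inv_eq_of_mul_eq_one_left (by rw [← sq, hy])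
    rw [← conj_pow, ← inv_pow, mul_inv_rev, hx', hy', ← mul_assoc, ← sq, hx, one_mul]
  · refine hm.of_dvd_nat (orderOf_dvd_of_pow_eq_one ?_)
    rw [← pow_mul, ← hkm, pow_orderOf_eq_one]

/-- A finite group without nontrivial real elements of odd order has a normal Sylow
`2`-subgroup. -/
theorem exists_normal_sylow_two_of_forall_isConj_inv (n : ℕ) :
    ∀ {G : Type*} [Group G] [Finite G], Nat.card G = n →
      (∀ x : G, IsConj x x⁻¹ → Odd (orderOf x) → x = 1) →
      ∃ P : Sylow 2 G, (P : Subgroup G).Normal := by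
  induction n using Nat.strong_induction_on with
  | _ n ih =>
    intro G _ _ hn hG
    by_cases h2 : 2 ∣ Nat.card G
    · obtain ⟨t, ht⟩ := exists_prime_orderOf_dvd_card' 2 h2
      have hN := isPGroup_normalClosure_of_involution hG (t := t) (by rw [← ht, pow_orderOf_eq_one])
      set N := Subgroup.normalClosure {t}
      have htN : t ∈ N := Subgroup.subset_normalClosure rfl
      have hlt : Nat.card (G ⧸ N) < n := by
        rw [← hn, N.card_eq_card_quotient_mul_card_subgroup]
        refine lt_mul_of_one_lt_right Nat.card_pos ?_
        rw [Subgroup.one_lt_card_iff_ne_bot]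
        intro hbot
        rw [hbot, Subgroup.mem_bot] at htN
        simp [htN] at ht
      obtain ⟨P, hP⟩ := ih _ hlt rfl (eq_one_of_isConj_inv_of_odd_quotient hG hN)
      have hcomap := P.2.comap_of_ker_isPGroup (QuotientGroup.mk' N)
        (by rwa [QuotientGroup.ker_mk'])
      refine ⟨hcomap.toSylow ?_, hP.comap _⟩
      rw [Subgroup.index_comap_of_surjective _ (QuotientGroup.mk'_surjective N)]
      exact P.not_dvd_index
    · refine ⟨(IsPGroup.of_bot (p := 2) (G := G)).toSylow (by rwa [Subgroup.index_bot]), ?_⟩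
      rw [IsPGroup.toSylow_coe]
      infer_instance

/-- In a group of odd order, only the identity is real. -/
theorem eq_one_of_isConj_inv_of_odd_card {G : Type*} [Group G] [Finite G]
    (hG : Odd (Nat.card G)) {x : G} (hx : IsConj x x⁻¹) : x = 1 := by
  obtain ⟨c, hc⟩ := isConj_iff.1 hx
  have hpow (k : ℕ) (hk : Odd k) : c ^ k * x * (c ^ k)⁻¹ = x⁻¹ := by
    obtain ⟨j, rfl⟩ := hk
    induction j with
    | zero => simpa using hc
    | succ j ih =>
      have h2 : c * (c * x * c⁻¹) * c⁻¹ = x := by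
        rw [hc, ← conj_inv, hc, inv_inv]
      calc _ = c ^ (2 * j + 1) * (c * (c * x * c⁻¹) * c⁻¹) * (c ^ (2 * j + 1))⁻¹ := by
              rw [show 2 * (j + 1) + 1 = (2 * j + 1) + 2 by ring, pow_add _ _ 2]; group
        _ = x⁻¹ := by rw [h2, ih]
  have h := hpow _ hG
  rw [pow_card_eq_one', one_mul, inv_one, mul_one] at h
  have hsq : x ^ 2 = 1 := by rw [sq]; nth_rewrite 1 [h]; simp
  rw [← orderOf_eq_one_iff]
  exact Nat.eq_one_of_dvd_coprimes (Nat.coprime_two_left.2 hG) (orderOf_dvd_of_pow_eq_one hsq)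
    (orderOf_dvd_natCard x)

/-- A finite group `G` has no nontrivial real element of odd order if and only if `G`
has a normal Sylow 2-subgroup. -/
theorem stmt_8 {G : Type*} [Group G] [Finite G] :
    (∀ x : G, IsConj x x⁻¹ → Odd (orderOf x) → x = 1) ↔
      ∃ P : Sylow 2 G, (P : Subgroup G).Normal := by
  refine ⟨exists_normal_sylow_two_of_forall_isConj_inv _ rfl, ?_⟩
  rintro ⟨P, hP⟩ x hx hodd
  have hcard : Odd (Nat.card (G ⧸ (P : Subgroup G))) := by
    rw [← Nat.not_even_iff_odd, even_iff_two_dvd]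
    exact P.not_dvd_index
  have hxP : x ∈ (P : Subgroup G) := by
    rw [← QuotientGroup.eq_one_iff]
    exact eq_one_of_isConj_inv_of_odd_card hcard
      ((QuotientGroup.mk' (P : Subgroup G)).map_isConj hx)
  obtain ⟨k, hk⟩ := P.2 ⟨x, hxP⟩
  rw [← orderOf_eq_one_iff]
  exact ((Nat.coprime_two_right.2 hodd).pow_right k).eq_one_of_dvd
    (orderOf_dvd_of_pow_eq_one (by simpa [Subtype.ext_iff] using hk))
end

section
/- Let G be a finite group. Assume that every real element of G of 2-power order lies in the center Z(G). Then G has a normal 2-complement, i.e., G has a normal subgroup of odd order whose index is a power of 2. -/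
open scoped commutatorElement

/-- Frobenius' condition at the prime `p`: every element of order coprime to `p` which normalizes a
`p`-subgroup centralizes it. -/
def FrobeniusCondition (p : ℕ) (G : Type*) [Group G] : Prop :=
  ∀ D : Subgroup G, IsPGroup p D → ∀ q : G, (orderOf q).Coprime p →
    (∀ x ∈ D, q * x * q⁻¹ ∈ D) → ∀ x ∈ D, q * x = x * q

theorem FrobeniusCondition.subgroup {p : ℕ} {G : Type*} [Group G] (hG : FrobeniusCondition p G)
    (K : Subgroup G) : FrobeniusCondition p K := by
  intro D hD q hq hqD x hx
  have key := hG (D.map K.subtype) (hD.map _) q (by simpa using hq) ?_ x ⟨x, hx, rfl⟩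
  · exact Subtype.ext key
  · rintro _ ⟨y, hy, rfl⟩
    exact ⟨q * y * q⁻¹, hqD y hy, by simp⟩

theorem IsPGroup.exists_mem_normalizer_notMem {p : ℕ} [Fact p.Prime] {G : Type*} [Group G]
    [Finite G] {D S : Subgroup G} (hS : IsPGroup p S) (hDS : D < S) :
    ∃ x ∈ S, x ∉ D ∧ x ∈ Subgroup.normalizer (D : Set G) := by
  have hlt : D.subgroupOf S < ⊤ := by
    rw [lt_top_iff_ne_top, Ne, Subgroup.subgroupOf_eq_top]
    exact not_le_of_gt hDS
  have := hS.isNilpotent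
  obtain ⟨-, x, hx, hxD⟩ := SetLike.lt_iff_le_and_exists.mp
    (Group.normalizerCondition_of_isNilpotent (G := S) _ hlt)
  refine ⟨x, x.2, fun h => hxD h, ?_⟩
  rw [Subgroup.mem_normalizer_iff] at hx ⊢
  intro y
  constructor
  · intro hy
    exact (hx ⟨y, hDS.le hy⟩).mp hy
  · intro hy
    have hyS : y ∈ S := by
      have := S.mul_mem (S.mul_mem (S.inv_mem x.2) (hDS.le hy)) x.2
      simpa [mul_assoc] using this
    exact (hx ⟨y, hyS⟩).mpr hy

/-- Under Frobenius' condition, the normalizer of a `p`-subgroup `D` is the product of any of its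
Sylow `p`-subgroups and the centralizer of `D`. -/
theorem FrobeniusCondition.exists_mem_sylow_mul {p : ℕ} [Fact p.Prime] {G : Type*} [Group G]
    [Finite G] (hG : FrobeniusCondition p G) {D : Subgroup G} (hD : IsPGroup p D)
    (A : Sylow p (Subgroup.normalizer (D : Set G))) (n : Subgroup.normalizer (D : Set G)) :
    ∃ a ∈ A, ∃ c : Subgroup.normalizer (D : Set G),
      (c : G) ∈ Subgroup.centralizer (D : Set G) ∧ n = a * c := by
  let N := Subgroup.normalizer (D : Set G)
  set C := (Subgroup.centralizer (D : Set G)).subgroupOf N with hC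
  have hCn : C.Normal := by
    refine ⟨fun c hc g => ?_⟩
    rw [hC, Subgroup.mem_subgroupOf, Subgroup.mem_centralizer_iff] at hc ⊢
    intro x hx
    have hx' : (g : G)⁻¹ * x * g ∈ D := by
      have := (Subgroup.mem_normalizer_iff.mp (N.inv_mem g.2) x).mp hx
      simpa using this
    have := hc _ hx'
    simp only [Subgroup.coe_mul, Subgroup.coe_inv]
    calc x * (g * c * (g : G)⁻¹) = g * ((g : G)⁻¹ * x * g * c) * (g : G)⁻¹ := by group
      _ = g * (c * ((g : G)⁻¹ * x * g)) * (g : G)⁻¹ := by rw [this]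
      _ = g * c * (g : G)⁻¹ * x := by group
  have hp : p.Prime := Fact.out
  have hquot : IsPGroup p (N ⧸ C) := by
    intro y
    obtain ⟨g, rfl⟩ := QuotientGroup.mk_surjective y
    obtain ⟨k, m, hm, hkm⟩ := Nat.exists_eq_pow_mul_and_not_dvd
      (orderOf_pos g).ne' p hp.ne_one
    refine ⟨k, ?_⟩
    rw [← QuotientGroup.mk_pow, QuotientGroup.eq_one_iff, hC, Subgroup.mem_subgroupOf,
      Subgroup.mem_centralizer_iff]
    have hord : orderOf (g ^ p ^ k) = m := by
      rw [orderOf_pow_of_dvd (pow_ne_zero _ hp.ne_zero) (hkm ▸ dvd_mul_right _ _), hkm,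
        Nat.mul_div_cancel_left _ (pow_pos hp.pos _)]
    intro x hx
    refine (hG D hD ((g ^ p ^ k : N) : G) ?_ ?_ x hx).symm
    · rw [Subgroup.orderOf_coe, hord]
      exact ((Nat.Prime.coprime_iff_not_dvd hp).mpr hm).symm
    · exact fun x hx => (Subgroup.mem_normalizer_iff.mp (g ^ p ^ k).2 x).mp hx
  have htop : (A : Subgroup N) ⊔ C = ⊤ := by
    rw [← Subgroup.index_eq_one]
    obtain ⟨k, hk⟩ := IsPGroup.iff_card.mp hquot
    have h1 : ((A : Subgroup N) ⊔ C).index ∣ p ^ k := by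
      rw [← hk, ← Subgroup.index_eq_card]
      exact Subgroup.index_dvd_of_le le_sup_right
    have h2 : ¬ p ∣ ((A : Subgroup N) ⊔ C).index := fun h =>
      A.not_dvd_index (h.trans (Subgroup.index_dvd_of_le le_sup_left))
    obtain ⟨j, -, hj⟩ := (Nat.dvd_prime_pow hp).mp h1
    rw [hj] at h2 ⊢
    rcases j with _ | j
    · simp
    · exact absurd (dvd_pow_self p j.succ_ne_zero) h2
  obtain ⟨a, ha, c, hc, h⟩ := Subgroup.mem_sup_of_normal_right.mp (htop.ge (Subgroup.mem_top n))
  exact ⟨a, ha, c, hc, h.symm⟩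

/-- Under Frobenius' condition, any two Sylow `p`-subgroups are conjugate by an element
centralizing their intersection. -/
theorem FrobeniusCondition.exists_mem_centralizer_smul_eq {p : ℕ} [Fact p.Prime] {G : Type*}
    [Group G] [Finite G] (hG : FrobeniusCondition p G) (P S : Sylow p G) :
    ∃ c ∈ Subgroup.centralizer (((P : Subgroup G) ⊓ S : Subgroup G) : Set G), c • S = P := by
  generalize hD : (P : Subgroup G) ⊓ S = D
  induction D using WellFoundedGT.induction generalizing P S with
  | ind D ih =>
  by_cases hPS : P = S
  · exact ⟨1, one_mem _, by rw [one_smul, hPS]⟩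
  have hDP : D < P := by
    refine lt_of_le_of_ne (hD ▸ inf_le_left) fun h => hPS ?_
    have hle : (P : Subgroup G) ≤ S := by rw [← h, ← hD]; exact inf_le_right
    exact (Sylow.ext (P.3 S.2 hle)).symm
  have hDS : D < S := by
    refine lt_of_le_of_ne (hD ▸ inf_le_right) fun h => hPS ?_
    have hle : (S : Subgroup G) ≤ P := by rw [← h, ← hD]; exact inf_le_left
    exact Sylow.ext (S.3 P.2 hle)
  have hDp : IsPGroup p D := P.2.to_le hDP.le
  set N := Subgroup.normalizer (D : Set G)
  obtain ⟨x, hxP, hxD, hxN⟩ := P.2.exists_mem_normalizer_notMem hDP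
  obtain ⟨y, hyS, hyD, hyN⟩ := S.2.exists_mem_normalizer_notMem hDS
  obtain ⟨A, hA⟩ := (P.2.comap_subtype (K := N)).exists_le_sylow
  obtain ⟨B, hB⟩ := (S.2.comap_subtype (K := N)).exists_le_sylow
  obtain ⟨P₁, hP₁⟩ := A.exists_comap_subtype_eq
  obtain ⟨n, hn⟩ := MulAction.exists_smul_eq N B A
  obtain ⟨a, ha, c, hc, rfl⟩ := hG.exists_mem_sylow_mul hDp A n
  have hcB : c • B = A := by
    rw [mul_smul, smul_eq_iff_eq_inv_smul] at hn
    rw [hn, Sylow.smul_eq_iff_mem_normalizer]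
    exact Subgroup.le_normalizer (A.inv_mem ha)
  have hAP₁ : ∀ z : N, z ∈ A → (z : G) ∈ P₁ := fun z hz => by
    have : z ∈ (A : Subgroup N) := hz
    rwa [← hP₁] at this
  have hDN : D ≤ N := Subgroup.le_normalizer
  have hconj : ∀ z : N, (z : G) ∈ S → (c : G) * z * (c : G)⁻¹ ∈ P₁ ∧
      (c : G) * z * (c : G)⁻¹ ∈ (c : G) • S := fun z hz => by
    constructor
    · have : c * z * c⁻¹ ∈ c • B := ⟨z, hB hz, rfl⟩
      rw [hcB] at this
      exact hAP₁ _ this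
    · exact ⟨z, hz, rfl⟩
  have hcD : ∀ z ∈ D, (c : G) * z * (c : G)⁻¹ = z := fun z hz => by
    rw [← Subgroup.mem_centralizer_iff.mp hc z hz, mul_inv_cancel_right]
  have h₁ : D < (P : Subgroup G) ⊓ P₁ := by
    refine lt_of_le_of_ne (le_inf hDP.le fun z hz => hAP₁ ⟨z, hDN hz⟩ (hA (hDP.le hz))) ?_
    intro h
    exact hxD (h.ge ⟨hxP, hAP₁ ⟨x, hxN⟩ (hA hxP)⟩)
  have h₂ : D < (P₁ : Subgroup G) ⊓ ((c : G) • S : Sylow p G) := by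
    refine lt_of_le_of_ne (fun z hz => ?_) ?_
    · rw [← hcD z hz]
      exact hconj ⟨z, hDN hz⟩ (hDS.le hz)
    · intro h
      have hmem : (c : G) * y * (c : G)⁻¹ ∈ D := h.ge <| hconj ⟨y, hyN⟩ hyS
      exact hyD ((Subgroup.mem_normalizer_iff.mp c.2 y).mpr hmem)
  obtain ⟨c₁, hc₁, e₁⟩ := ih _ h₁ P P₁ rfl
  obtain ⟨c₂, hc₂, e₂⟩ := ih _ h₂ P₁ ((c : G) • S) rfl
  refine ⟨c₁ * (c₂ * c), mul_mem ?_ (mul_mem ?_ hc), by rw [mul_smul, mul_smul, e₂, e₁]⟩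
  · exact Subgroup.centralizer_le h₁.le hc₁
  · exact Subgroup.centralizer_le h₂.le hc₂

theorem FrobeniusCondition.focalSubgroup_le {p : ℕ} [Fact p.Prime] {G : Type*} [Group G]
    [Finite G] (hG : FrobeniusCondition p G) (P : Sylow p G) :
    (P : Subgroup G).focalSubgroup ≤ ⁅(P : Subgroup G), (P : Subgroup G)⁆ := by
  rw [Subgroup.focalSubgroup_def, Subgroup.closure_le]
  rintro _ ⟨hmem, x, hx, u, rfl⟩
  have hw : u * x⁻¹ * u⁻¹ ∈ (P : Subgroup G) := by
    have := mul_mem (inv_mem hx) hmem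
    simpa [commutatorElement_def, mul_assoc] using this
  obtain ⟨c, hc, hcu⟩ := hG.exists_mem_centralizer_smul_eq P (u • P)
  have hcw := Subgroup.mem_centralizer_iff.mp hc (u * x⁻¹ * u⁻¹) ⟨hw, x⁻¹, inv_mem hx, rfl⟩
  rw [← mul_smul, Sylow.smul_eq_iff_mem_normalizer] at hcu
  obtain ⟨a, ha, d, hd, had⟩ := hG.exists_mem_sylow_mul P.2
    (P.subtype Subgroup.le_normalizer) ⟨c * u, hcu⟩
  have had' : c * u = a * d := congrArg Subtype.val had
  have hdx := Subgroup.mem_centralizer_iff.mp hd x⁻¹ (inv_mem hx)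
  have key : u * x⁻¹ * u⁻¹ = a * x⁻¹ * (a : G)⁻¹ := by
    calc u * x⁻¹ * u⁻¹ = u * x⁻¹ * u⁻¹ * c * c⁻¹ := by group
      _ = (c * u) * x⁻¹ * (c * u)⁻¹ := by rw [hcw]; group
      _ = a * (d * x⁻¹) * (d : G)⁻¹ * (a : G)⁻¹ := by rw [had']; group
      _ = a * x⁻¹ * (a : G)⁻¹ := by rw [← hdx]; group
  have : ⁅x, u⁆ = ⁅x, (a : G)⁆ := by
    calc ⁅x, u⁆ = x * (u * x⁻¹ * u⁻¹) := by rw [commutatorElement_def]; group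
      _ = ⁅x, (a : G)⁆ := by rw [key, commutatorElement_def]; group
  rw [this]
  exact Subgroup.commutator_mem_commutator hx ha

/-- A normal subgroup of `p`-power index with a normal `p`-complement transfers the latter to
the whole group. -/
theorem exists_normal_complement_of_normal {p : ℕ} [Fact p.Prime] {G : Type*} [Group G] [Finite G]
    (K : Subgroup G) [K.Normal] (hK : ∃ k, K.index = p ^ k)
    (h : ∃ M : Subgroup K, M.Normal ∧ (Nat.card M).Coprime p ∧ ∃ k, M.index = p ^ k) :
    ∃ M : Subgroup G, M.Normal ∧ (Nat.card M).Coprime p ∧ ∃ k, M.index = p ^ k := by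
  obtain ⟨M, hM, hcop, j, hj⟩ := h
  obtain ⟨k, hk⟩ := hK
  have hmem : ∀ x : K, (orderOf x).Coprime p → x ∈ M := fun x hx => by
    rw [← QuotientGroup.eq_one_iff, ← orderOf_eq_one_iff]
    refine Nat.eq_one_of_dvd_coprimes (hx.pow_right j)
      (orderOf_map_dvd (QuotientGroup.mk' M) x) ?_
    rw [← hj, Subgroup.index_eq_card]
    exact orderOf_dvd_natCard _
  refine ⟨M.map K.subtype, ⟨?_⟩, ?_, j + k, ?_⟩
  · rintro _ ⟨x, hx, rfl⟩ g
    refine ⟨⟨g * x * g⁻¹, ‹K.Normal›.conj_mem x x.2 g⟩, hmem _ ?_, rfl⟩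
    have hconj : orderOf (g * x * g⁻¹) = orderOf x := by
      have := orderOf_injective (MulAut.conj g).toMonoidHom (MulAut.conj g).injective (x : G)
      simpa using this
    rw [Subgroup.orderOf_mk, hconj]
    exact hcop.coprime_dvd_left (Subgroup.orderOf_dvd_natCard _ hx)
  · rwa [Subgroup.card_map_of_injective K.subtype_injective]
  · rw [Subgroup.index_map_subtype, hj, hk, pow_add]

/-- **Frobenius' normal `p`-complement theorem**. -/
theorem FrobeniusCondition.exists_normal_complement {p : ℕ} [Fact p.Prime] {G : Type*} [Group G]
    [Finite G] (hG : FrobeniusCondition p G) :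
    ∃ M : Subgroup G, M.Normal ∧ (Nat.card M).Coprime p ∧ ∃ k, M.index = p ^ k := by
  induction hn : Nat.card G using Nat.strong_induction_on generalizing G with
  | h n ih =>
  let P : Sylow p G := default
  by_cases hP : (P : Subgroup G) = ⊥
  · refine ⟨⊤, inferInstance, ?_, 0, by simp⟩
    have := P.not_dvd_index
    rw [hP, Subgroup.index_bot] at this
    rw [Subgroup.card_top]
    exact ((Nat.Prime.coprime_iff_not_dvd Fact.out).mpr this).symm
  have hnil := P.2.isNilpotent
  have hlt : ⁅(P : Subgroup G), (P : Subgroup G)⁆ < P := by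
    have : Nontrivial (P : Subgroup G) := (Subgroup.nontrivial_iff_ne_bot _).mpr hP
    have := Subgroup.map_subtype_lt_map_subtype.mpr
      (Group.IsSolvable.commutator_lt_top_of_nontrivial (P : Subgroup G))
    rwa [Subgroup.map_subtype_commutator, ← MonoidHom.range_eq_map, Subgroup.range_subtype]
      at this
  set K := (P : Subgroup G).transferFocal.ker with hK
  have hKtop : K ≠ ⊤ := fun h => by
    have hfoc := Subgroup.ker_transferFocal_inf_eq_focalSubgroup P
    rw [← hK, h, top_inf_eq] at hfoc
    exact absurd (hG.focalSubgroup_le P) (hfoc ▸ not_le_of_gt hlt)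
  refine exists_normal_complement_of_normal K ?_ (ih (Nat.card K) ?_ (hG.subgroup K) rfl)
  · have := (P.2.to_quotient (P : Subgroup G).focalSubgroupOf).to_subgroup
      (P : Subgroup G).transferFocal.range
    rw [hK, Subgroup.index_ker]
    exact IsPGroup.iff_card.mp this
  · rw [← hn, ← Subgroup.card_top (G := G)]
    refine lt_of_le_of_ne (Subgroup.card_le_card_group K |>.trans_eq Subgroup.card_top.symm) ?_
    rw [Subgroup.card_top]
    exact fun h => hKtop (Subgroup.eq_top_of_card_eq K h)

/-- If every real `2`-element is central, an element of odd order normalizing a `2`-subgroup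
centralizes it: if `q` fixes `x ^ 2`, then `x` inverts `x⁻¹ * (q * x * q⁻¹)`. -/
theorem frobeniusCondition_two_of_real_mem_center {G : Type*} [Group G] [Finite G]
    (h : ∀ x : G, IsConj x x⁻¹ → (∃ n : ℕ, orderOf x = 2 ^ n) → x ∈ Subgroup.center G) :
    FrobeniusCondition 2 G := by
  intro D hD q hq hqD x hx
  obtain ⟨k, hk⟩ := hD ⟨x, hx⟩
  replace hk : x ^ 2 ^ k = 1 := congrArg Subtype.val hk
  induction k generalizing x with
  | zero =>
    have : x = 1 := by simpa using hk
    simp [this]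
  | succ k ih =>
    have hsq : q * x ^ 2 = x ^ 2 * q := ih (x ^ 2) (pow_mem hx 2) (by
      rw [← pow_mul, ← pow_succ', hk])
    set y := x⁻¹ * (q * x * q⁻¹) with hy
    have hyD : y ∈ D := mul_mem (inv_mem hx) (hqD x hx)
    have hw : (q * x * q⁻¹) * (q * x * q⁻¹) = x * x := by
      calc (q * x * q⁻¹) * (q * x * q⁻¹) = q * x ^ 2 * q⁻¹ := by rw [pow_two]; group
        _ = x * x := by rw [hsq, pow_two]; group
    have hinv : x⁻¹ * y * x = y⁻¹ := by
      rw [eq_inv_iff_mul_eq_one]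
      calc x⁻¹ * y * x * y = x⁻¹ * x⁻¹ * ((q * x * q⁻¹) * (q * x * q⁻¹)) := by rw [hy]; group
        _ = 1 := by rw [hw]; group
    have hyc : y ∈ Subgroup.center G := by
      refine h y (isConj_iff.mpr ⟨x⁻¹, by rwa [inv_inv]⟩) ?_
      obtain ⟨m, hm⟩ := IsPGroup.iff_orderOf.mp hD ⟨y, hyD⟩
      exact ⟨m, by rw [← hm, Subgroup.orderOf_mk]⟩
    have hcomm : ∀ g, g * y = y * g := Subgroup.mem_center_iff.mp hyc
    have hy2 : y ^ 2 = 1 := by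
      rw [mul_assoc, ← hcomm, inv_mul_cancel_left, eq_inv_iff_mul_eq_one] at hinv
      rw [pow_two, hinv]
    have hqx : q * x * q⁻¹ = x * y := by rw [hy]; group
    have hiter : ∀ n : ℕ, q ^ n * x * (q ^ n)⁻¹ = x * y ^ n := by
      intro n
      induction n with
      | zero => simp
      | succ n ihn =>
        have hcn : q⁻¹ * y ^ n = y ^ n * q⁻¹ :=
          (show Commute q⁻¹ y from hcomm q⁻¹).pow_right n
        calc q ^ (n + 1) * x * (q ^ (n + 1))⁻¹ = q * (q ^ n * x * (q ^ n)⁻¹) * q⁻¹ := by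
              rw [pow_succ']; group
          _ = (q * x * q⁻¹) * y ^ n := by rw [ihn]; simp only [mul_assoc, hcn]
          _ = x * y ^ (n + 1) := by rw [hqx, pow_succ', mul_assoc]
    have hyq : y ^ orderOf q = 1 := by
      have := hiter (orderOf q)
      rw [pow_orderOf_eq_one] at this
      simpa using this
    have hy1 : y = 1 := by
      rw [← orderOf_eq_one_iff]
      exact Nat.eq_one_of_dvd_coprimes hq (orderOf_dvd_of_pow_eq_one hyq)
        (orderOf_dvd_of_pow_eq_one hy2)
    rw [hy1, mul_one] at hqx
    exact mul_inv_eq_iff_eq_mul.mp hqx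

/-- If every real element of 2-power order of a finite group `G` lies in the center,
then `G` has a normal 2-complement. -/
theorem stmt_9 {G : Type*} [Group G] [Finite G]
    (h : ∀ x : G, IsConj x x⁻¹ → (∃ n : ℕ, orderOf x = 2 ^ n) → x ∈ Subgroup.center G) :
    ∃ N : Subgroup G, N.Normal ∧ Odd (Nat.card N) ∧ ∃ k : ℕ, N.index = 2 ^ k := by
  obtain ⟨N, hN, hcop, k, hk⟩ :=
    (frobeniusCondition_two_of_real_mem_center h).exists_normal_complement
  exact ⟨N, hN, Nat.coprime_two_right.mp hcop, k, hk⟩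
end

section
/- Let G be a finite group and let b ≥ 0 be an integer such that for every real element y of G not lying in the center Z(G), the 2-part of |C_G(y)| equals 2^b. Let x ∈ G be a real element not in Z(G) whose order is 2m for some integer m > 1. Then x^m lies in Z(G). -/
/-- The subgroup of elements conjugating `x` to `x` or to `x⁻¹`. -/
def extendedCentralizer {G : Type*} [Group G] (x : G) : Subgroup G where
  carrier := {a | a * x * a⁻¹ = x ∨ a * x * a⁻¹ = x⁻¹}
  one_mem' := by simp
  mul_mem' := by
    rintro a c ha hc
    have key : a * c * x * (a * c)⁻¹ = a * (c * x * c⁻¹) * a⁻¹ := by group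
    have inv : a * x⁻¹ * a⁻¹ = (a * x * a⁻¹)⁻¹ := by group
    simp only [Set.mem_ofPred_eq] at ha hc ⊢
    rw [key]
    rcases hc with hc | hc <;> rw [hc]
    · exact ha
    · rw [inv]
      rcases ha with ha | ha <;> simp [ha]
  inv_mem' := by
    rintro a (ha | ha)
    · left
      nth_rewrite 1 [← ha]
      group
    · right
      have hconj : a⁻¹ * x⁻¹ * a = x := by rw [← ha]; group
      calc a⁻¹ * x * a⁻¹⁻¹ = (a⁻¹ * x⁻¹ * a)⁻¹ := by group
        _ = x⁻¹ := by rw [hconj]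

theorem mem_centralizer_singleton_iff_conj_eq {G : Type*} [Group G] {x a : G} :
    a ∈ Subgroup.centralizer {x} ↔ a * x * a⁻¹ = x := by
  rw [Subgroup.mem_centralizer_singleton_iff, mul_inv_eq_iff_eq_mul]

theorem centralizer_le_extendedCentralizer {G : Type*} [Group G] (x : G) :
    Subgroup.centralizer {x} ≤ extendedCentralizer x := fun _ ha =>
  Or.inl (mem_centralizer_singleton_iff_conj_eq.1 ha)

/-- If `x` is real and `x ≠ x⁻¹`, the centralizer of `x` has index two in the extended
centralizer. -/
theorem card_extendedCentralizer {G : Type*} [Group G] {x : G}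
    (hx : IsConj x x⁻¹) (hne : x ≠ x⁻¹) :
    Nat.card (extendedCentralizer x) = 2 * Nat.card (Subgroup.centralizer {x}) := by
  obtain ⟨g, hg⟩ := isConj_iff.1 hx
  have hidx : (Subgroup.centralizer {x}).relIndex (extendedCentralizer x) = 2 := by
    rw [Subgroup.relIndex, Subgroup.index_eq_two_iff]
    refine ⟨⟨g, Or.inr hg⟩, fun ⟨a, ha⟩ => ?_⟩
    have key : a * g * x * (a * g)⁻¹ = (a * x * a⁻¹)⁻¹ := by
      calc a * g * x * (a * g)⁻¹ = a * (g * x * g⁻¹) * a⁻¹ := by group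
        _ = (a * x * a⁻¹)⁻¹ := by rw [hg]; group
    simp only [Subgroup.mem_subgroupOf, Subgroup.coe_mul,
      mem_centralizer_singleton_iff_conj_eq, key]
    rcases ha with ha | ha
    · exact Or.inr ⟨ha, by rw [ha]; exact hne.symm⟩
    · exact Or.inl ⟨by rw [ha, inv_inv], by rw [ha]; exact hne.symm⟩
  rw [← Subgroup.relIndex_bot_left, ← Subgroup.relIndex_bot_left,
    ← Subgroup.relIndex_mul_relIndex _ _ _ bot_le (centralizer_le_extendedCentralizer x), hidx,
    mul_comm]

theorem extendedCentralizer_le_centralizer_pow {G : Type*} [Group G] {x : G} {m : ℕ}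
    (hinv : (x ^ m)⁻¹ = x ^ m) :
    extendedCentralizer x ≤ Subgroup.centralizer {x ^ m} := by
  intro a ha
  rw [mem_centralizer_singleton_iff_conj_eq, ← conj_pow]
  rcases ha with ha | ha
  · rw [ha]
  · rw [ha, inv_pow, hinv]

/-- Suppose every real element `y ∉ Z(G)` of a finite group `G` has centralizer whose
order has 2-part `2 ^ b`. If `x` is a real element not in `Z(G)` of order `2 * m` with
`m > 1`, then `x ^ m ∈ Z(G)`. -/
theorem stmt_10 {G : Type*} [Group G] [Finite G] (b : ℕ)
    (h : ∀ y : G, IsConj y y⁻¹ → y ∉ Subgroup.center G →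
      (Nat.card (Subgroup.centralizer {y})).factorization 2 = b)
    (x : G) (hx : IsConj x x⁻¹) (hxc : x ∉ Subgroup.center G)
    (m : ℕ) (hm : 1 < m) (ho : orderOf x = 2 * m) :
    x ^ m ∈ Subgroup.center G := by
  by_contra hz
  have hinv : (x ^ m)⁻¹ = x ^ m := by
    rw [inv_eq_iff_mul_eq_one, ← pow_add, ← two_mul, ← ho, pow_orderOf_eq_one]
  have hne : x ≠ x⁻¹ := by
    intro he
    have hsq : x ^ 2 = 1 := by rw [pow_two, mul_eq_one_iff_eq_inv]; exact he
    have := Nat.le_of_dvd two_pos (orderOf_dvd_of_pow_eq_one hsq)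
    omega
  have hzb := h (x ^ m) (by rw [hinv]) hz
  have hxb := h x hx hxc
  have hdvd := Subgroup.card_dvd_of_le (extendedCentralizer_le_centralizer_pow hinv)
  rw [card_extendedCentralizer hx hne] at hdvd
  have hle := (Nat.factorization_le_iff_dvd
    (mul_ne_zero two_ne_zero Nat.card_pos.ne') Nat.card_pos.ne').2 hdvd 2
  rw [Nat.factorization_mul two_ne_zero Nat.card_pos.ne', Finsupp.add_apply,
    Nat.prime_two.factorization_self] at hle
  omega
end

section
/- Let G be a finite group and let b ≥ 0 be an integer such that for every real element y of G not lying in the center Z(G), the 2-part of |C_G(y)| equals 2^b. Let x ∈ G be a real element of 2-power order not lying in Z(G), and let t ∈ G be an element of 2-power order with x^t = x^{-1}. Then the centralizer C_G(⟨x, t⟩) of the subgroup generated by x and t has a normal Sylow 2-subgroup. In particular, if i is an involution of G not lying in Z(G), then C_G(i) has a normal Sylow 2-subgroup. -/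
/-- The subgroup of elements commuting with `x` and either fixing or inverting `y` under
conjugation. -/
def centralizerFixOrInvert {G : Type*} [Group G] (x y : G) : Subgroup G where
  carrier := {g | Commute g x ∧ (SemiconjBy g y y ∨ SemiconjBy g y y⁻¹)}
  one_mem' := ⟨Commute.one_left x, Or.inl (SemiconjBy.one_left y)⟩
  mul_mem' := by
    rintro g k ⟨hg, hg'⟩ ⟨hk, hk'⟩
    refine ⟨hg.mul_left hk, ?_⟩
    rcases hg' with hg' | hg' <;> rcases hk' with hk' | hk'
    · exact Or.inl (hg'.mul_left hk')
    · exact Or.inr (hg'.inv_right.mul_left hk')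
    · exact Or.inr (hg'.mul_left hk')
    · left
      simpa using hg'.inv_right.mul_left hk'
  inv_mem' := by
    rintro g ⟨hg, hg'⟩
    refine ⟨hg.inv_left, ?_⟩
    rcases hg' with hg' | hg'
    · exact Or.inl hg'.inv_symm_left
    · right
      simpa using hg'.inv_symm_left.inv_right

/-- An element of odd order equal to its inverse is trivial. -/
theorem eq_one_of_odd_orderOf_of_eq_inv {G : Type*} [Group G] {y : G} (hy : Odd (orderOf y))
    (h : y = y⁻¹) : y = 1 := by
  have h2 : orderOf y ∣ 2 := orderOf_dvd_of_pow_eq_one (by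
    rw [pow_two]; nth_rewrite 2 [h]; exact mul_inv_cancel y)
  rcases (Nat.dvd_prime Nat.prime_two).1 h2 with h1 | h1
  · exact orderOf_eq_one_iff.1 h1
  · rw [h1] at hy
    exact absurd hy (by decide)

/-- If all noncentral real elements have centralizers with the same 2-part, then an odd order
element inverted by some `s` is trivial when it and `s` both centralize a noncentral 2-element
`x` together with an element `t` inverting `x`. -/
theorem eq_one_of_odd_orderOf_of_semiconjBy_inv {G : Type*} [Group G] [Finite G] {b : ℕ}
    (h : ∀ y : G, IsConj y y⁻¹ → y ∉ Subgroup.center G →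
      (Nat.card (Subgroup.centralizer {y})).factorization 2 = b)
    {x t s y : G} (hxc : x ∉ Subgroup.center G) (hx2 : ∃ n : ℕ, orderOf x = 2 ^ n)
    (ht : SemiconjBy t x x⁻¹) (hsx : Commute s x) (hyx : Commute y x) (hyt : Commute y t)
    (hy : Odd (orderOf y)) (hs : SemiconjBy s y y⁻¹) : y = 1 := by
  have hcop : (orderOf y).Coprime (orderOf x) := by
    obtain ⟨n, hn⟩ := hx2
    rw [hn]
    exact (Nat.coprime_two_right.2 hy).pow_right n
  have hx_of : ∀ g : G, Commute g (x * y) → Commute g x := by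
    intro g hg
    obtain ⟨m, hm⟩ := exists_pow_eq_self_of_coprime hcop
    have h1 := (hg.pow_right (orderOf y)).pow_right m
    rwa [hyx.symm.mul_pow, pow_orderOf_eq_one, mul_one, hm] at h1
  have hxreal : IsConj x x⁻¹ := isConj_iff.2 ⟨t, mul_inv_eq_iff_eq_mul.2 ht⟩
  have hxyreal : IsConj (x * y) (x * y)⁻¹ := by
    refine isConj_iff.2 ⟨t * s, mul_inv_eq_iff_eq_mul.2 ?_⟩
    have h1 : SemiconjBy (t * s) x x⁻¹ := ht.mul_left hsx
    have h2 : SemiconjBy (t * s) y y⁻¹ := SemiconjBy.mul_left (hyt.symm.inv_right) hs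
    rw [hyx.symm.mul_inv]
    exact h1.mul_right h2
  have hxyc : x * y ∉ Subgroup.center G := fun hc => hxc <| Subgroup.mem_center_iff.2 fun g =>
    hx_of g (Subgroup.mem_center_iff.1 hc g)
  by_contra hy1
  have hle : centralizerFixOrInvert x y ≤ Subgroup.centralizer {x} := fun g hg =>
    Subgroup.mem_centralizer_singleton_iff.2 hg.1.eq
  have hBE : Subgroup.centralizer {x * y} ≤ centralizerFixOrInvert x y := by
    intro g hg
    have hg' : Commute g (x * y) := Subgroup.mem_centralizer_singleton_iff.1 hg
    have hgx := hx_of g hg'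
    refine ⟨hgx, Or.inl ?_⟩
    change Commute g y
    simpa using hgx.inv_right.mul_right hg'
  have hindex : (Subgroup.centralizer {x * y}).relIndex (centralizerFixOrInvert x y) = 2 := by
    refine Subgroup.relIndex_eq_two_iff_exists_notMem_and.2
      ⟨s, ⟨hsx, Or.inr hs⟩, fun hsm => ?_, ?_⟩
    · obtain hsc : Commute s (x * y) := Subgroup.mem_centralizer_singleton_iff.1 hsm
      have hsy : Commute s y := by simpa using hsx.inv_right.mul_right hsc
      exact hy1 (eq_one_of_odd_orderOf_of_eq_inv hy
        (mul_right_cancel (hsy.eq.symm.trans hs.eq)))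
    · rintro g ⟨hgx, hg | hg⟩
      · right
        exact Subgroup.mem_centralizer_singleton_iff.2 (Commute.mul_right hgx hg).eq
      · left
        have h1 : SemiconjBy (g * s) y y := by
          simpa using hg.inv_right.mul_left hs
        exact Subgroup.mem_centralizer_singleton_iff.2
          (Commute.mul_right (hgx.mul_left hsx) h1).eq
  have hcard : Nat.card (Subgroup.centralizer {x * y}) * 2 ∣
      Nat.card (Subgroup.centralizer {x}) := by
    rw [← hindex, ← Subgroup.relIndex_bot_left (Subgroup.centralizer {x * y}),
      Subgroup.relIndex_mul_relIndex _ _ _ bot_le hBE, Subgroup.relIndex_bot_left]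
    exact Subgroup.card_dvd_of_le hle
  have hfac := (Nat.factorization_le_iff_dvd (by simp [Nat.card_pos.ne'])
    Nat.card_pos.ne').2 hcard 2
  rw [Nat.factorization_mul Nat.card_pos.ne' (by norm_num), Finsupp.add_apply,
    h _ hxyreal hxyc, h _ hxreal hxc, Nat.prime_two.factorization_self] at hfac
  omega

/-- If every real element of odd order in a finite group is trivial, then the same holds in the
quotient by a normal 2-subgroup. -/
theorem odd_orderOf_real_quotient_eq_one {K : Type*} [Group K] [Finite K]
    (hK : ∀ y s : K, Odd (orderOf y) → SemiconjBy s y y⁻¹ → y = 1)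
    (N : Subgroup K) [N.Normal] (hN : IsPGroup 2 N) (y s : K ⧸ N) (hy : Odd (orderOf y))
    (hs : SemiconjBy s y y⁻¹) : y = 1 := by
  by_contra hy1
  have hord : orderOf y ≠ 1 := mt orderOf_eq_one_iff.1 hy1
  obtain ⟨r, hr, hrdvd⟩ := Nat.exists_prime_and_dvd hord
  have hrodd : Odd r := hy.of_dvd_nat hrdvd
  have : Fact r.Prime := ⟨hr⟩
  obtain ⟨k, hk⟩ := hrdvd
  have hzord : orderOf (y ^ k) = r := by
    have hk0 : k ≠ 0 := by
      rintro rfl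
      exact (orderOf_pos y).ne' (by simpa using hk)
    rw [orderOf_pow_of_dvd hk0 ⟨r, by rw [hk, mul_comm]⟩, hk,
      Nat.mul_div_cancel _ (Nat.pos_of_ne_zero hk0)]
  have hzs : SemiconjBy s (y ^ k) (y ^ k)⁻¹ := by
    simpa using hs.pow_right k
  generalize y ^ k = z at hzord hzs
  obtain ⟨m, hm⟩ := IsPGroup.iff_card.1 hN
  obtain ⟨H, hH⟩ : ∃ H, H = (Subgroup.zpowers z).comap (QuotientGroup.mk' N) := ⟨_, rfl⟩
  have hHcard : Nat.card H = 2 ^ m * r := by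
    have h1 : H.index = (Subgroup.zpowers z).index := hH ▸
      Subgroup.index_comap_of_surjective _ (QuotientGroup.mk'_surjective N)
    have h2 := H.card_mul_index
    have h3 := N.card_mul_index
    have h4 := (Subgroup.zpowers z).card_mul_index
    rw [Nat.card_zpowers, hzord] at h4
    rw [Subgroup.index_eq_card N, ← h4, hm] at h3
    rw [h1, ← h3, ← mul_assoc] at h2
    exact Nat.eq_of_mul_eq_mul_right (Nat.pos_of_ne_zero Subgroup.index_ne_zero_of_finite) h2
  have hfac : (Nat.card H).factorization r = 1 := by
    have hr2 : r ≠ 2 := by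
      rintro rfl
      exact absurd hrodd (by decide)
    rw [hHcard, Nat.factorization_mul (by positivity) hr.ne_zero, Nat.factorization_pow,
      Nat.prime_two.factorization]
    simp [hr.factorization_self, hr2.symm]
  obtain ⟨c, hc⟩ := exists_prime_orderOf_dvd_card' (G := H) r ⟨2 ^ m, by rw [hHcard, mul_comm]⟩
  have hcz : SemiconjBy s ((c : K) : K ⧸ N) ((c : K) : K ⧸ N)⁻¹ := by
    obtain ⟨j, hj⟩ := Subgroup.mem_zpowers_iff.1 (Subgroup.mem_comap.1 (hH.le c.2))
    rw [QuotientGroup.mk'_apply] at hj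
    rw [← hj]
    simpa using hzs.zpow_right j
  obtain ⟨u, rfl⟩ := QuotientGroup.mk_surjective s
  have hdH : u * c * u⁻¹ ∈ H := by
    have : QuotientGroup.mk' N (u * c * u⁻¹) = (QuotientGroup.mk' N c)⁻¹ := by
      simpa using mul_inv_eq_iff_eq_mul.2 hcz.eq
    refine hH.ge (Subgroup.mem_comap.2 ?_)
    rw [this]
    exact inv_mem (Subgroup.mem_comap.1 (hH.le c.2))
  have hdord : orderOf (⟨u * c * u⁻¹, hdH⟩ : H) = r := by
    rw [← Subgroup.orderOf_coe, ← hc, ← Subgroup.orderOf_coe]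
    exact (MulAut.conj u).orderOf_eq (c : K)
  have hcard : ∀ a : H, orderOf a = r →
      Nat.card (Subgroup.zpowers a) = r ^ (Nat.card H).factorization r := by
    intro a ha
    rw [hfac, pow_one, Nat.card_zpowers, ha]
  obtain ⟨g, hg⟩ := MulAction.exists_smul_eq H
    (Sylow.ofCard (Subgroup.zpowers (⟨u * c * u⁻¹, hdH⟩ : H)) (hcard _ hdord))
    (Sylow.ofCard (Subgroup.zpowers c) (hcard _ hc))
  have hmem : g * ⟨u * c * u⁻¹, hdH⟩ * g⁻¹ ∈ Subgroup.zpowers c := by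
    have h1 : g * ⟨u * c * u⁻¹, hdH⟩ * g⁻¹ ∈
        g • Sylow.ofCard (Subgroup.zpowers (⟨u * c * u⁻¹, hdH⟩ : H)) (hcard _ hdord) := by
      rw [← SetLike.mem_coe, Sylow.coe_smul]
      exact ⟨_, Subgroup.mem_zpowers _, rfl⟩
    rwa [hg] at h1
  obtain ⟨j, hj⟩ := Subgroup.mem_zpowers_iff.1 hmem
  have hjK : (c : K) ^ j = g * (u * c * u⁻¹) * (g : K)⁻¹ := by
    simpa using congrArg (Subtype.val) hj
  -- modulo `N` the element `g` commutes with `c`, so the exponent is `-1`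
  have hgc : Commute ((g : K) : K ⧸ N) ((c : K) : K ⧸ N) := by
    obtain ⟨i, hi⟩ := Subgroup.mem_zpowers_iff.1 (Subgroup.mem_comap.1 (hH.le c.2))
    obtain ⟨l, hl⟩ := Subgroup.mem_zpowers_iff.1 (Subgroup.mem_comap.1 (hH.le g.2))
    rw [QuotientGroup.mk'_apply] at hi hl
    rw [← hi, ← hl]
    exact (Commute.refl z).zpow_zpow l i
  have hmod : ((c : K) : K ⧸ N) ^ j = ((c : K) : K ⧸ N)⁻¹ := by
    have h1 := congrArg (QuotientGroup.mk' N) hjK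
    simp only [map_mul, map_inv, map_zpow, QuotientGroup.mk'_apply] at h1
    rw [h1, mul_inv_eq_iff_eq_mul.2 hcz.eq, hgc.inv_right.eq, mul_inv_cancel_right]
  have hjN : (c : K) ^ (j + 1) ∈ N := by
    rw [← QuotientGroup.eq_one_iff, QuotientGroup.mk_zpow, zpow_add_one, hmod, inv_mul_cancel]
  have hcK : orderOf (c : K) = r := by rw [Subgroup.orderOf_coe, hc]
  have hinv : (c : K) ^ (j + 1) = 1 := by
    obtain ⟨l, hl⟩ := IsPGroup.iff_orderOf.1 hN ⟨_, hjN⟩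
    rw [← Subgroup.orderOf_coe] at hl
    have h1 : orderOf ((c : K) ^ (j + 1)) ∣ r := by
      rw [← hcK]
      exact orderOf_dvd_of_mem_zpowers (Subgroup.mem_zpowers_iff.2 ⟨_, rfl⟩)
    have h2 : orderOf ((c : K) ^ (j + 1)) ∣ 2 ^ l := hl.dvd
    exact orderOf_eq_one_iff.1 (Nat.eq_one_of_dvd_coprimes
      ((Nat.coprime_two_right.2 hrodd).pow_right l) h1 h2)
  have hc1 : (c : K) = 1 := by
    refine hK c (g * u) (by rwa [hcK]) (mul_inv_eq_iff_eq_mul.1 ?_)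
    rw [← eq_inv_of_mul_eq_one_left ((zpow_add_one (c : K) j).symm.trans hinv), hjK]
    group
  rw [hc1, orderOf_one] at hcK
  exact hr.ne_one hcK.symm

/-- Auxiliary form of `exists_sylow_two_normal`, set up for induction on the group order. -/
theorem exists_sylow_two_normal_of_card {n : ℕ} : ∀ {K : Type*} [Group K] [Finite K],
    Nat.card K = n → (∀ y s : K, Odd (orderOf y) → SemiconjBy s y y⁻¹ → y = 1) →
      ∃ P : Sylow 2 K, (P : Subgroup K).Normal := by
  induction n using Nat.strong_induction_on with
  | _ n ih =>
  intro K _ _ hn hK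
  by_cases hN : ∃ N : Subgroup K, N.Normal ∧ IsPGroup 2 N ∧ N ≠ ⊥
  · obtain ⟨N, hNn, hN2, hNbot⟩ := hN
    have hlt : Nat.card (K ⧸ N) < n := by
      rw [← hn, ← N.card_mul_index, ← Subgroup.index_eq_card]
      exact lt_mul_of_one_lt_left (Nat.pos_of_ne_zero Subgroup.index_ne_zero_of_finite)
        (N.one_lt_card_iff_ne_bot.2 hNbot)
    obtain ⟨P, hP⟩ := ih _ hlt rfl (odd_orderOf_real_quotient_eq_one hK N hN2)
    have hker : IsPGroup 2 (QuotientGroup.mk' N).ker := by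
      rwa [QuotientGroup.ker_mk']
    refine ⟨P.comapOfKerIsPGroup (QuotientGroup.mk' N) hker ?_, ?_⟩
    · rw [MonoidHom.range_eq_top.2 (QuotientGroup.mk'_surjective N)]
      exact le_top
    · rw [Sylow.coe_comapOfKerIsPGroup]
      exact hP.comap _
  have hlocal : ∀ D : Subgroup K, IsPGroup 2 D → D ≠ ⊥ → ∃ S : Sylow 2 K,
      ∀ E : Subgroup K, IsPGroup 2 E → E ≤ Subgroup.normalizer D → E ≤ S := by
    intro D hD hDbot
    have hlt : Nat.card (Subgroup.normalizer (D : Set K)) < n := by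
      rw [← hn]
      refine lt_of_le_of_ne (Subgroup.card_le_card_group _) fun he => hN ⟨D, ?_, hD, hDbot⟩
      exact Subgroup.normalizer_eq_top_iff.1 (Subgroup.eq_top_of_card_eq _ he)
    obtain ⟨T, hT⟩ := ih _ hlt rfl (fun y s hy hs => by
      refine Subtype.ext (hK y s ?_ (congrArg Subtype.val hs.eq))
      rwa [Subgroup.orderOf_coe])
    obtain ⟨S, hS⟩ := (T.isPGroup'.map (Subgroup.normalizer (D : Set K)).subtype).exists_le_sylow
    refine ⟨S, fun E hE hEle => le_trans ?_ hS⟩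
    have := hT
    have h1 : E.subgroupOf (Subgroup.normalizer (D : Set K)) ≤ T := by
      have h2 : IsPGroup 2 (E.subgroupOf (Subgroup.normalizer (D : Set K))) := hE.comap_subtype
      obtain ⟨T', hT'⟩ := h2.exists_le_sylow
      have := T.unique_of_normal hT
      rwa [Subsingleton.elim T' T] at hT'
    have h3 := Subgroup.map_mono (f := (Subgroup.normalizer (D : Set K)).subtype) h1
    rwa [Subgroup.subgroupOf_map_subtype, inf_eq_left.2 hEle] at h3
  have hunique : ∀ D : Subgroup K, D ≠ ⊥ → ∀ P Q : Sylow 2 K, D ≤ P → D ≤ Q → P = Q := by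
    intro D
    induction D using WellFoundedGT.induction with
    | _ D ihD =>
    intro hDbot P Q hDP hDQ
    rcases eq_or_lt_of_le hDP with hDP' | hDP'
    · exact (Sylow.ext (P.3 Q.2 (hDP' ▸ hDQ))).symm
    rcases eq_or_lt_of_le hDQ with hDQ' | hDQ'
    · exact Sylow.ext (Q.3 P.2 (hDQ' ▸ hDP))
    obtain ⟨S, hS⟩ := hlocal D (P.2.to_le hDP) hDbot
    have key : ∀ R : Sylow 2 K, D < R → R = S := by
      intro R hDR
      have hlt : D < Subgroup.normalizer D ⊓ R := by
        refine lt_of_le_of_ne (le_inf Subgroup.le_normalizer hDR.le) fun he => ?_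
        have := R.2.isNilpotent
        have hcond := normalizerCondition_iff_only_full_group_self_normalizing.1
          (Group.normalizerCondition_of_isNilpotent (G := R)) (D.subgroupOf R) (by
            rw [← Subgroup.subgroupOf_normalizer_eq hDR.le,
              ← Subgroup.inf_subgroupOf_right, ← he])
        exact hDR.not_ge (Subgroup.subgroupOf_eq_top.1 hcond)
      exact ihD _ hlt (ne_bot_of_gt hlt) R S inf_le_right
        (hS _ (R.2.to_le inf_le_right) inf_le_left)
    rw [key P hDP', key Q hDQ']
  obtain ⟨P⟩ : Nonempty (Sylow 2 K) := inferInstance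
  by_cases hPQ : ∀ Q : Sylow 2 K, Q = P
  · have : Subsingleton (Sylow 2 K) := ⟨fun Q R => (hPQ Q).trans (hPQ R).symm⟩
    exact ⟨P, P.normal_of_subsingleton⟩
  exfalso
  obtain ⟨Q, hQ⟩ := not_forall.1 hPQ
  have h2card : 2 ∣ Nat.card K := by
    by_contra h2
    have hbot : ∀ R : Sylow 2 K, (R : Subgroup K) = ⊥ := fun R => by
      rw [← Subgroup.card_eq_one, R.card_eq_multiplicity,
        Nat.factorization_eq_zero_of_not_dvd h2, pow_zero]
    exact hQ (Sylow.ext ((hbot Q).trans (hbot P).symm))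
  have hinvol : ∀ R : Sylow 2 K, ∃ i ∈ R, orderOf i = 2 := fun R => by
    obtain ⟨i, hi⟩ := exists_prime_orderOf_dvd_card' (G := R) 2 (R.dvd_card_of_dvd_card h2card)
    exact ⟨i, i.2, (Subgroup.orderOf_coe i).trans hi⟩
  obtain ⟨i, hiP, hi⟩ := hinvol P
  obtain ⟨j, hjQ, hj⟩ := hinvol Q
  have hne : ∀ g : K, orderOf g = 2 → Subgroup.zpowers g ≠ ⊥ := fun g hg hb => by
    rw [Subgroup.zpowers_eq_bot.1 hb, orderOf_one] at hg
    omega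
  have hpgroup : ∀ g : K, orderOf g = 2 → IsPGroup 2 (Subgroup.zpowers g) := fun g hg =>
    IsPGroup.of_card (n := 1) (by rw [Nat.card_zpowers, hg, pow_one])
  have hself : ∀ g : K, orderOf g = 2 → g⁻¹ = g := fun g hg =>
    inv_eq_of_mul_eq_one_left (by rw [← pow_two, ← hg, pow_orderOf_eq_one])
  have hii := hself i hi
  have hjj := hself j hj
  have hwi : SemiconjBy i (i * j) (i * j)⁻¹ := by
    rw [mul_inv_rev, hii, hjj]
    change i * (i * j) = j * i * i
    rw [mul_assoc j, ← mul_assoc, show i * i = 1 by nth_rewrite 2 [← hii]; exact mul_inv_cancel i]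
    simp
  have hwj : SemiconjBy j (i * j) (i * j)⁻¹ := by
    rw [mul_inv_rev, hii, hjj]
    change j * (i * j) = j * i * j
    rw [mul_assoc]
  rcases Nat.even_or_odd (orderOf (i * j)) with hev | hodd
  · obtain ⟨k, hk⟩ := hev
    have hpos := orderOf_pos (i * j)
    have hz : orderOf ((i * j) ^ k) = 2 := by
      rw [orderOf_pow_of_dvd (by omega) ⟨2, by omega⟩]
      exact Nat.div_eq_of_eq_mul_left (by omega) (by omega)
    have hcomm : ∀ g : K, SemiconjBy g (i * j) (i * j)⁻¹ → Commute g ((i * j) ^ k) := by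
      intro g hg
      have h1 := hg.pow_right k
      rwa [inv_pow, hself _ hz] at h1
    generalize (i * j) ^ k = z at hz hcomm
    obtain ⟨S, hS⟩ := hlocal _ (hpgroup z hz) (hne z hz)
    have hnorm : ∀ g : K, Commute g z →
        Subgroup.zpowers g ≤ Subgroup.normalizer (Subgroup.zpowers z) := by
      intro g hg
      rw [Subgroup.zpowers_le, Subgroup.mem_normalizer_iff_map_conj_eq, MonoidHom.map_zpowers]
      exact congrArg _ (mul_inv_eq_iff_eq_mul.2 hg.eq)
    exact hQ ((hunique _ (hne j hj) Q S (Subgroup.zpowers_le.2 hjQ)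
      (hS _ (hpgroup j hj) (hnorm j (hcomm j hwj)))).trans
      (hunique _ (hne i hi) P S (Subgroup.zpowers_le.2 hiP)
      (hS _ (hpgroup i hi) (hnorm i (hcomm i hwi)))).symm)
  · have h1 := hK _ _ hodd hwi
    have hij : i = j := by rw [eq_inv_of_mul_eq_one_left h1, hjj]
    exact hQ (hunique _ (hne i hi) Q P (Subgroup.zpowers_le.2 (hij ▸ hjQ))
      (Subgroup.zpowers_le.2 hiP))

/-- A finite group in which every real element of odd order is trivial has a normal Sylow
2-subgroup. -/
theorem exists_sylow_two_normal {K : Type*} [Group K] [Finite K]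
    (hK : ∀ y s : K, Odd (orderOf y) → SemiconjBy s y y⁻¹ → y = 1) :
    ∃ P : Sylow 2 K, (P : Subgroup K).Normal :=
  exists_sylow_two_normal_of_card rfl hK


/-- Suppose every real element `y ∉ Z(G)` of a finite group `G` has centralizer whose
order has 2-part `2 ^ b`. If `x ∉ Z(G)` is a real element of 2-power order and `t` is
an element of 2-power order inverting `x`, then `C_G(⟨x, t⟩)` has a normal Sylow
2-subgroup. In particular, the centralizer of any non-central involution of `G` has a
normal Sylow 2-subgroup. -/
theorem stmt_11 {G : Type*} [Group G] [Finite G] (b : ℕ)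
    (h : ∀ y : G, IsConj y y⁻¹ → y ∉ Subgroup.center G →
      (Nat.card (Subgroup.centralizer {y})).factorization 2 = b)
    (x t : G) (hx : IsConj x x⁻¹) (hxc : x ∉ Subgroup.center G)
    (hx2 : ∃ n : ℕ, orderOf x = 2 ^ n) (ht2 : ∃ n : ℕ, orderOf t = 2 ^ n)
    (hinv : t⁻¹ * x * t = x⁻¹) :
    (∃ P : Sylow 2 (Subgroup.centralizer ((Subgroup.closure {x, t} : Subgroup G) : Set G)),
        (P : Subgroup (Subgroup.centralizer
          ((Subgroup.closure {x, t} : Subgroup G) : Set G))).Normal) ∧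
      ∀ i : G, orderOf i = 2 → i ∉ Subgroup.center G →
        ∃ P : Sylow 2 (Subgroup.centralizer {i}),
          (P : Subgroup (Subgroup.centralizer {i})).Normal := by
  have hcentr : ∀ (C : Subgroup G) (x t : G), x ∉ Subgroup.center G →
      (∃ n : ℕ, orderOf x = 2 ^ n) → SemiconjBy t x x⁻¹ →
      (∀ g ∈ C, Commute g x ∧ Commute g t) → ∃ P : Sylow 2 C, (P : Subgroup C).Normal := by
    intro C x t hxc hx2 hinv hC
    refine exists_sylow_two_normal fun y s hy hs => Subtype.ext ?_
    refine eq_one_of_odd_orderOf_of_semiconjBy_inv h hxc hx2 hinv (hC s s.2).1 (hC y y.2).1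
      (hC y y.2).2 ?_ (congrArg Subtype.val hs.eq)
    rwa [Subgroup.orderOf_coe]
  refine ⟨hcentr _ x t hxc hx2 ?_ fun g hg => ?_, fun i hi hic => ?_⟩
  · have h1 : SemiconjBy t x⁻¹ x := by
      change t * x⁻¹ = x * t
      rw [← hinv]
      group
    simpa using h1.inv_right
  · rw [Subgroup.centralizer_closure, Subgroup.mem_centralizer_iff] at hg
    exact ⟨(hg x (by simp)).symm, (hg t (by simp)).symm⟩
  · refine hcentr _ i 1 hic ⟨1, by rw [hi, pow_one]⟩ ?_ fun g hg =>
      ⟨Subgroup.mem_centralizer_singleton_iff.1 hg, Commute.one_right g⟩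
    have h1 : i⁻¹ = i := inv_eq_of_mul_eq_one_left (by rw [← pow_two, ← hi, pow_orderOf_eq_one])
    rw [h1]
    exact SemiconjBy.one_left i
end

section
/- Let G be a finite group and let b ≥ 0 be an integer such that for every real element x of G not lying in the center Z(G), the 2-part of |C_G(x)| equals 2^b. Let K be a normal subgroup of G of odd index. Then for every real element x of K not lying in the center Z(K), the 2-part of |C_K(x)| equals 2^b. -/
/-- Suppose every real element `x ∉ Z(G)` of a finite group `G` has centralizer whose
order has 2-part `2 ^ b`. If `K` is a normal subgroup of odd index, then every real
element `x ∉ Z(K)` of `K` has centralizer in `K` whose order has 2-part `2 ^ b`. -/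
theorem stmt_12 {G : Type*} [Group G] [Finite G] (b : ℕ)
    (h : ∀ x : G, IsConj x x⁻¹ → x ∉ Subgroup.center G →
      (Nat.card (Subgroup.centralizer {x})).factorization 2 = b)
    (K : Subgroup G) [K.Normal] (hodd : Odd K.index) :
    ∀ x : K, IsConj x x⁻¹ → x ∉ Subgroup.center K →
      (Nat.card (Subgroup.centralizer {x})).factorization 2 = b := by
  intro x hx hxc
  have hC : Subgroup.centralizer {x} = (Subgroup.centralizer {(x : G)}).subgroupOf K := by
    ext y
    simp [Subgroup.mem_subgroupOf, Subgroup.mem_centralizer_singleton_iff, Subtype.ext_iff]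
  have hcard : Nat.card (Subgroup.centralizer {x}) * K.relIndex (Subgroup.centralizer {(x : G)}) =
      Nat.card (Subgroup.centralizer {(x : G)}) := by
    rw [hC, ← (K.subgroupOf (Subgroup.centralizer {(x : G)})).card_mul_index, Subgroup.relIndex,
      ← Subgroup.inf_subgroupOf_right, ← Subgroup.inf_subgroupOf_right K,
      Nat.card_congr (Subgroup.subgroupOfEquivOfLe inf_le_right).toEquiv,
      Nat.card_congr (Subgroup.subgroupOfEquivOfLe inf_le_right).toEquiv, inf_comm]
  have hrel : Odd (K.relIndex (Subgroup.centralizer {(x : G)})) :=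
    hodd.of_dvd_nat (K.relIndex_dvd_index_of_normal _)
  have hb := h x (by simpa using K.subtype.map_isConj hx) fun hc => hxc <|
    Subgroup.mem_center_iff.mpr fun y => Subtype.ext (Subgroup.mem_center_iff.mp hc y)
  rw [← hcard, Nat.factorization_mul Nat.card_pos.ne' hrel.pos.ne', Finsupp.add_apply,
    Nat.factorization_eq_zero_of_not_dvd hrel.not_two_dvd_nat, add_zero] at hb
  exact hb
end

section
/- Let G be a finite group and let N be a normal subgroup of G of odd order. Suppose the coset xN is a real element of the quotient group G/N. Then there exist an element y ∈ G with yN = xN and an element t ∈ G of 2-power order such that y^t = y^{-1}. -/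
/-- The permutation `y ↦ t⁻¹ y⁻¹ t` of a group; its fixed points are the elements inverted
by `t`. -/
def invConjPerm {G : Type*} [Group G] (t : G) : Equiv.Perm G :=
  (Equiv.inv G).trans (MulAut.conj t⁻¹).toEquiv

theorem invConjPerm_apply {G : Type*} [Group G] (t y : G) :
    invConjPerm t y = t⁻¹ * y⁻¹ * t := by
  simp [invConjPerm]

theorem invConjPerm_pow_two_mul_apply {G : Type*} [Group G] (t : G) (k : ℕ) (y : G) :
    (invConjPerm t ^ (2 * k)) y = (t ^ (2 * k))⁻¹ * y * t ^ (2 * k) := by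
  induction k with
  | zero => simp
  | succ k ih =>
    rw [show 2 * (k + 1) = 2 + 2 * k by ring, pow_add, Equiv.Perm.mul_apply, ih,
      pow_two, Equiv.Perm.mul_apply, invConjPerm_apply, invConjPerm_apply,
      show 2 + 2 * k = 2 * k + 1 + 1 by ring, pow_succ, pow_succ]
    group

theorem invConjPerm_pow_eq_one {G : Type*} [Group G] {t : G} {n : ℕ}
    (ht : orderOf t = 2 ^ n) : invConjPerm t ^ 2 ^ (n + 1) = 1 := by
  ext y
  have h : t ^ (2 * 2 ^ n) = 1 := by rw [← ht, mul_comm, pow_mul, pow_orderOf_eq_one, one_pow]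
  rw [pow_succ', invConjPerm_pow_two_mul_apply, h]
  simp

/-- A coset of odd size mapped to its inverse by a 2-element `t` contains an element
inverted by `t`. -/
theorem exists_inverted_of_odd_card {G : Type*} [Group G] [Finite G] (N : Subgroup G)
    [N.Normal] (hodd : Odd (Nat.card N)) (x t : G) {n : ℕ} (ht : orderOf t = 2 ^ n)
    (hxt : (t : G ⧸ N)⁻¹ * (x : G ⧸ N) * t = (x : G ⧸ N)⁻¹) :
    ∃ y : G, (y : G ⧸ N) = x ∧ t⁻¹ * y * t = y⁻¹ := by
  have hinv : (t : G ⧸ N)⁻¹ * (x : G ⧸ N)⁻¹ * t = x := by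
    simpa [mul_assoc] using congrArg (·⁻¹) hxt
  let σ : Equiv.Perm {y : G // (y : G ⧸ N) = x} := (invConjPerm t).subtypePerm fun y => by
    rw [invConjPerm_apply, QuotientGroup.mk_mul, QuotientGroup.mk_mul, QuotientGroup.mk_inv,
      QuotientGroup.mk_inv]
    nth_rewrite 1 [← hinv]
    simp
  have hcard : Nat.card {y : G // (y : G ⧸ N) = x} = Nat.card N :=
    Nat.card_congr
      { toFun := fun y => ⟨x⁻¹ * y, QuotientGroup.eq.mp y.2.symm⟩
        invFun := fun m => ⟨x * m, by simp⟩
        left_inv := fun y => by simp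
        right_inv := fun m => by simp }
  have hσ : σ ^ 2 ^ (n + 1) = 1 := by
    ext y
    simp [σ, Equiv.Perm.subtypePerm_pow, invConjPerm_pow_eq_one ht]
  have := Fintype.ofFinite {y : G // (y : G ⧸ N) = x}
  obtain ⟨⟨y, hy⟩, hfix⟩ := Equiv.Perm.exists_fixed_point_of_prime (p := 2)
    (by rw [← Nat.card_eq_fintype_card, hcard]; exact hodd.not_two_dvd_nat) hσ
  refine ⟨y, hy, ?_⟩
  have h : t⁻¹ * y⁻¹ * t = y := by
    rw [← invConjPerm_apply]; exact congrArg Subtype.val hfix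
  simpa [mul_assoc] using congrArg (·⁻¹) h

/-- An odd power of an element that inverts `a` inverts `a`. -/
theorem pow_inverts_of_odd {H : Type*} [Group H] {a g : H} (h : g⁻¹ * a * g = a⁻¹) {m : ℕ}
    (hm : Odd m) : (g ^ m)⁻¹ * a * g ^ m = a⁻¹ := by
  obtain ⟨k, rfl⟩ := hm
  induction k with
  | zero => simpa using h
  | succ k ih =>
    have h' : g⁻¹ * a⁻¹ * g = a := by simpa [mul_assoc] using congrArg (·⁻¹) h
    calc (g ^ (2 * (k + 1) + 1))⁻¹ * a * g ^ (2 * (k + 1) + 1)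
        = g⁻¹ * (g⁻¹ * ((g ^ (2 * k + 1))⁻¹ * a * g ^ (2 * k + 1)) * g) * g := by
          rw [show 2 * (k + 1) + 1 = 2 * k + 1 + 1 + 1 by ring, pow_succ _ (2 * k + 1 + 1),
            pow_succ _ (2 * k + 1)]
          group
      _ = a⁻¹ := by rw [ih, h', h]

/-- Let `N` be a normal subgroup of odd order of a finite group `G`. If the coset `xN`
is a real element of `G/N`, then there are `y ∈ G` with `yN = xN` and an element
`t ∈ G` of 2-power order with `y^t = y⁻¹`. -/
theorem stmt_13 {G : Type*} [Group G] [Finite G] (N : Subgroup G) [N.Normal]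
    (hodd : Odd (Nat.card N)) (x : G)
    (hx : IsConj (QuotientGroup.mk' N x) (QuotientGroup.mk' N x)⁻¹) :
    ∃ y t : G, QuotientGroup.mk' N y = QuotientGroup.mk' N x ∧
      (∃ n : ℕ, orderOf t = 2 ^ n) ∧ t⁻¹ * y * t = y⁻¹ := by
  obtain ⟨c, hc⟩ := isConj_iff.mp hx
  obtain ⟨g, hg⟩ := QuotientGroup.mk_surjective c⁻¹
  have hgx : (g : G ⧸ N)⁻¹ * (x : G ⧸ N) * g = (x : G ⧸ N)⁻¹ := by
    rw [hg, inv_inv]; exact hc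
  obtain ⟨n, m, hm, hnm⟩ := Nat.exists_eq_two_pow_mul_odd (orderOf_pos g).ne'
  have ht : orderOf (g ^ m) = 2 ^ n := by
    rw [orderOf_pow_of_dvd hm.pos.ne' (hnm ▸ dvd_mul_left m _), hnm,
      Nat.mul_div_cancel _ hm.pos]
  obtain ⟨y, hy, hyt⟩ := exists_inverted_of_odd_card N hodd x (g ^ m) ht
    (pow_inverts_of_odd hgx hm)
  exact ⟨y, g ^ m, hy, ⟨n, ht⟩, hyt⟩
end

section
/- Let G be a finite group and let N be a normal subgroup of G of odd order. Suppose the coset xN is a real element of G/N of 2-power order. Then there exist an element y ∈ G of 2-power order with yN = xN and an element t ∈ G of 2-power order such that y^t = y^{-1}. Moreover, if xN is an involution in G/N, then y can be chosen to be an involution in G. -/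
/-- An odd power of an element inverting `g` by conjugation also inverts `g`. -/
lemma SemiconjBy.pow_odd_inv {G : Type*} [Group G] {c g : G} (h : SemiconjBy c g g⁻¹) {m : ℕ}
    (hm : Odd m) : SemiconjBy (c ^ m) g g⁻¹ := by
  obtain ⟨k, rfl⟩ := hm
  have h2 : Commute (c ^ 2) g := by
    have := h.inv_right.mul_left h
    rwa [inv_inv, ← pow_two] at this
  rw [pow_succ', pow_mul]
  exact h.mul_left (h2.pow_left k)

/-- A real element of a finite group is inverted by an element of 2-power order. -/
lemma IsConj.exists_two_pow_semiconjBy_inv {G : Type*} [Group G] [Finite G] {g : G}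
    (h : IsConj g g⁻¹) : ∃ c : G, SemiconjBy c g g⁻¹ ∧ ∃ n : ℕ, orderOf c = 2 ^ n := by
  obtain ⟨c, hc⟩ := h
  obtain ⟨n, m, hm, hnm⟩ := Nat.exists_eq_two_pow_mul_odd (orderOf_pos (c : G)).ne'
  refine ⟨(c : G) ^ m, hc.pow_odd_inv hm, n, ?_⟩
  rw [orderOf_pow_of_dvd hm.pos.ne' (hnm ▸ dvd_mul_left _ _), hnm, Nat.mul_div_cancel _ hm.pos]

/-- Two elements of `p`-power order, one of which inverts the other, generate a `p`-group. -/
lemma IsPGroup.zpowers_sup_zpowers_of_semiconjBy_inv {G : Type*} [Group G] {p : ℕ}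
    {c g : G} (h : SemiconjBy c g g⁻¹) (hc : ∃ n : ℕ, orderOf c = p ^ n)
    (hg : ∃ n : ℕ, orderOf g = p ^ n) :
    IsPGroup p (Subgroup.zpowers c ⊔ Subgroup.zpowers g : Subgroup G) := by
  obtain ⟨a, ha⟩ := hc
  obtain ⟨b, hb⟩ := hg
  refine IsPGroup.to_sup_of_normal_right' (IsPGroup.of_card (n := a) (by rw [Nat.card_zpowers, ha]))
    (IsPGroup.of_card (n := b) (by rw [Nat.card_zpowers, hb])) ?_
  rw [Subgroup.zpowers_le, Subgroup.mem_normalizer_iff_map_conj_eq, MonoidHom.map_zpowers,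
    MonoidHom.coe_coe, MulAut.conj_apply, h.eq, mul_inv_cancel_right, Subgroup.zpowers_inv]

/-- A `p`-subgroup of the image of a surjective homomorphism of finite groups is contained in
the image of a Sylow `p`-subgroup. -/
lemma IsPGroup.exists_sylow_le_map {G H : Type*} [Group G] [Finite G] [Group H] {p : ℕ}
    [Fact p.Prime] {K : Subgroup H} (hK : IsPGroup p K) {f : G →* H}
    (hf : Function.Surjective f) : ∃ P : Sylow p G, K ≤ (P : Subgroup G).map f := by
  obtain ⟨Q, hQ⟩ := hK.exists_le_sylow
  obtain ⟨P, rfl⟩ := Sylow.mapSurjective_surjective hf p Q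
  exact ⟨P, hQ⟩

theorem stmt_14 {G : Type*} [Group G] [Finite G] (N : Subgroup G) [N.Normal]
    (hodd : Odd (Nat.card N)) (x : G)
    (hx : IsConj (QuotientGroup.mk' N x) (QuotientGroup.mk' N x)⁻¹)
    (hx2 : ∃ n : ℕ, orderOf (QuotientGroup.mk' N x) = 2 ^ n) :
    ∃ y t : G, QuotientGroup.mk' N y = QuotientGroup.mk' N x ∧
      (∃ n : ℕ, orderOf y = 2 ^ n) ∧ (∃ n : ℕ, orderOf t = 2 ^ n) ∧
      t⁻¹ * y * t = y⁻¹ ∧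
      (orderOf (QuotientGroup.mk' N x) = 2 → orderOf y = 2) := by
  obtain ⟨c, hc, hc2⟩ := hx.exists_two_pow_semiconjBy_inv
  obtain ⟨P, hP⟩ := (IsPGroup.zpowers_sup_zpowers_of_semiconjBy_inv hc hc2 hx2).exists_sylow_le_map
    (QuotientGroup.mk'_surjective N)
  obtain ⟨s, hs, rfl⟩ := hP (le_sup_left (α := Subgroup (G ⧸ N)) (Subgroup.mem_zpowers c))
  obtain ⟨y, hy, hyx⟩ := hP (le_sup_right (α := Subgroup (G ⧸ N)) (Subgroup.mem_zpowers _))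
  have hPN : Disjoint (P : Subgroup G) N := by
    obtain ⟨n, hn⟩ := IsPGroup.iff_card.mp P.isPGroup'
    refine Subgroup.disjoint_of_coprime_natCard ?_
    rw [hn]
    exact (Nat.coprime_two_left.mpr hodd).pow_left n
  have hone : ∀ g ∈ (P : Subgroup G), QuotientGroup.mk' N g = 1 → g = 1 := fun g hg h =>
    Subgroup.disjoint_def.mp hPN hg ((QuotientGroup.eq_one_iff g).mp h)
  have hord : orderOf y = orderOf (QuotientGroup.mk' N x) := by
    rw [← hyx, orderOf_eq_orderOf_iff]
    intro n
    rw [← map_pow]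
    exact ⟨fun h => by rw [h, map_one], hone _ (pow_mem hy n)⟩
  obtain ⟨n, hn⟩ := IsPGroup.iff_orderOf.mp P.isPGroup' ⟨s, hs⟩
  refine ⟨y, s⁻¹, hyx, hord ▸ hx2, ⟨n, ?_⟩, ?_, fun h => hord.trans h⟩
  · rw [orderOf_inv, ← hn, Subgroup.orderOf_mk]
  · rw [inv_inv, ← mul_eq_one_iff_eq_inv]
    refine hone _ (mul_mem (mul_mem (mul_mem hs hy) (inv_mem hs)) hy) ?_
    rw [map_mul, map_mul, map_mul, map_inv, hyx, hc.eq]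
    group
end

section
/- Let G be a finite group, let N be a normal subgroup of G of odd order, and write Ḡ = G/N. Let y, t ∈ G be elements of 2-power order with y^t = y^{-1}. Then the 2-part of the size of the conjugacy class of yN in Ḡ equals the 2-part of the size of the conjugacy class of y in G, and the centralizer in Ḡ of the subgroup generated by yN and tN equals the image in Ḡ of C_G(⟨y, t⟩). -/
/-- If `S` is a `p`-subgroup and `N` is a normal subgroup of order prime to `p`, then centralizers
of `S` lift from `G ⧸ N`. -/
theorem IsPGroup.centralizer_map_mk' {G : Type*} [Group G] {p : ℕ} [Fact p.Prime]
    (N : Subgroup G) [N.Normal] (hN : ¬ p ∣ Nat.card N) {S : Subgroup G} [Finite S]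
    (hS : IsPGroup p S) :
    Subgroup.centralizer ((S.map (QuotientGroup.mk' N) : Subgroup (G ⧸ N)) : Set (G ⧸ N)) =
      (Subgroup.centralizer (S : Set G)).map (QuotientGroup.mk' N) := by
  refine le_antisymm (fun x hx ↦ ?_) ?_
  · obtain ⟨g, rfl⟩ := QuotientGroup.mk'_surjective N x
    rw [Subgroup.mem_centralizer_iff] at hx
    -- `S` acts by conjugation on the coset `gN`, whose cardinality is prime to `p`.
    let : MulAction S {a : G // QuotientGroup.mk' N a = QuotientGroup.mk' N g} :=
      { smul := fun s a ↦ ⟨s * a * (s : G)⁻¹, by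
          rw [map_mul, map_mul, map_inv, a.2, hx _ (Subgroup.mem_map_of_mem _ s.2),
            mul_inv_cancel_right]⟩
        one_smul := fun a ↦ Subtype.ext (by
          change ((1 : S) : G) * (a : G) * ((1 : S) : G)⁻¹ = a
          simp)
        mul_smul := fun s r a ↦ Subtype.ext (by
          change ((s * r : S) : G) * (a : G) * ((s * r : S) : G)⁻¹ =
            (s : G) * ((r : G) * a * (r : G)⁻¹) * (s : G)⁻¹
          simp [mul_assoc]) }
    let e : N ≃ {a : G // QuotientGroup.mk' N a = QuotientGroup.mk' N g} :=
      (Equiv.mulLeft g).subtypeEquiv fun a ↦ by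
        change a ∈ N ↔ QuotientGroup.mk' N (g * a) = _
        rw [map_mul, mul_eq_left, QuotientGroup.mk'_apply, QuotientGroup.eq_one_iff]
    obtain ⟨c, hc⟩ := hS.nonempty_fixed_point_of_prime_not_dvd_card
      {a : G // QuotientGroup.mk' N a = QuotientGroup.mk' N g} (Nat.card_congr e ▸ hN)
    refine ⟨c, Subgroup.mem_centralizer_iff.mpr fun s hs ↦ ?_, c.2⟩
    exact mul_inv_eq_iff_eq_mul.mp (congrArg Subtype.val (hc ⟨s, hs⟩))
  · rw [Subgroup.coe_map]
    exact Subgroup.map_centralizer_le_centralizer_image _ _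

theorem Subgroup.card_conjugatesOf_mul_card_centralizer {G : Type*} [Group G] (g : G) :
    Nat.card (conjugatesOf g) * Nat.card (Subgroup.centralizer {g}) = Nat.card G := by
  rw [Subgroup.nat_card_centralizer_nat_card_stabilizer, mul_comm,
    Nat.card_congr (ConjAct.toConjAct (G := G)).toEquiv,
    ← Subgroup.card_mul_index (MulAction.stabilizer (ConjAct G) g), MulAction.index_stabilizer,
    ConjAct.orbit_eq_carrier_conjClasses]
  rfl

theorem Subgroup.card_map_mk'_mul_card_subgroupOf {G : Type*} [Group G] (N C : Subgroup G)
    [N.Normal] :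
    Nat.card (C.map (QuotientGroup.mk' N)) * Nat.card (N.subgroupOf C) = Nat.card C := by
  have hker : ((QuotientGroup.mk' N).comp C.subtype).ker = N.subgroupOf C := by
    rw [← MonoidHom.comap_ker, QuotientGroup.ker_mk']
    rfl
  have hrange : ((QuotientGroup.mk' N).comp C.subtype).range = C.map (QuotientGroup.mk' N) := by
    rw [MonoidHom.range_comp, Subgroup.range_subtype]
  rw [← hrange, ← Subgroup.index_ker, hker, mul_comm, Subgroup.card_mul_index]

/-- Passing to the quotient by a normal subgroup of order prime to `p` preserves the `p`-part of the class size
of a `p`-element. -/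
theorem IsPGroup.factorization_card_conjugatesOf_mk' {G : Type*} [Group G] [Finite G] {p : ℕ}
    [Fact p.Prime] (N : Subgroup G) [N.Normal] (hN : ¬ p ∣ Nat.card N) {y : G}
    (hy : IsPGroup p (Subgroup.zpowers y)) :
    (Nat.card (conjugatesOf (QuotientGroup.mk' N y))).factorization p =
      (Nat.card (conjugatesOf y)).factorization p := by
  have hC : Subgroup.centralizer {QuotientGroup.mk' N y} =
      (Subgroup.centralizer {y}).map (QuotientGroup.mk' N) := by
    have h := hy.centralizer_map_mk' N hN
    rwa [MonoidHom.map_zpowers, Subgroup.zpowers_eq_closure, Subgroup.zpowers_eq_closure,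
      Subgroup.centralizer_closure, Subgroup.centralizer_closure] at h
  have hbar := Subgroup.card_conjugatesOf_mul_card_centralizer (QuotientGroup.mk' N y)
  rw [hC] at hbar
  have hG := Subgroup.card_conjugatesOf_mul_card_centralizer y
  have hmap := Subgroup.card_map_mk'_mul_card_subgroupOf N (Subgroup.centralizer {y})
  have hquot := Subgroup.card_eq_card_quotient_mul_card_subgroup N
  have hK : ¬ p ∣ Nat.card (N.subgroupOf (Subgroup.centralizer {y})) := fun h ↦
    hN (h.trans (Subgroup.card_comap_dvd_of_injective N _ (Subgroup.subtype_injective _)))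
  have hpos : 0 < Nat.card ((Subgroup.centralizer {y}).map (QuotientGroup.mk' N)) := Nat.card_pos
  have hne : Nat.card (conjugatesOf y) ≠ 0 := left_ne_zero_of_mul (hG ▸ Nat.card_pos.ne')
  have hne' : Nat.card (conjugatesOf (QuotientGroup.mk' N y)) ≠ 0 :=
    left_ne_zero_of_mul (hbar ▸ Nat.card_pos.ne')
  have key : Nat.card (conjugatesOf (QuotientGroup.mk' N y)) * Nat.card N =
      Nat.card (conjugatesOf y) * Nat.card (N.subgroupOf (Subgroup.centralizer {y})) := by
    refine Nat.eq_of_mul_eq_mul_right hpos ?_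
    rw [mul_right_comm, hbar, ← hquot, ← hG, ← hmap]
    ring
  have h := congrArg (fun n ↦ n.factorization p) key
  simpa only [Nat.factorization_mul hne Nat.card_pos.ne',
    Nat.factorization_mul hne' Nat.card_pos.ne', Finsupp.add_apply,
    Nat.factorization_eq_zero_of_not_dvd hN, Nat.factorization_eq_zero_of_not_dvd hK,
    add_zero] using h

/-- Let `N` be a normal subgroup of odd order of a finite group `G`, and let `y, t ∈ G`
be elements of 2-power order with `y^t = y⁻¹`. Then the 2-part of the conjugacy class
size of `yN` in `G/N` equals the 2-part of the conjugacy class size of `y` in `G`, and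
`C_{G/N}(⟨yN, tN⟩)` is the image in `G/N` of `C_G(⟨y, t⟩)`. -/
theorem stmt_15 {G : Type*} [Group G] [Finite G] (N : Subgroup G) [N.Normal]
    (hodd : Odd (Nat.card N)) (y t : G)
    (hy2 : ∃ n : ℕ, orderOf y = 2 ^ n) (ht2 : ∃ n : ℕ, orderOf t = 2 ^ n)
    (hinv : t⁻¹ * y * t = y⁻¹) :
    (Nat.card (conjugatesOf (QuotientGroup.mk' N y))).factorization 2 =
        (Nat.card (conjugatesOf y)).factorization 2 ∧
      Subgroup.centralizer
          ((Subgroup.closure {QuotientGroup.mk' N y, QuotientGroup.mk' N t} :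
            Subgroup (G ⧸ N)) : Set (G ⧸ N)) =
        Subgroup.map (QuotientGroup.mk' N)
          (Subgroup.centralizer ((Subgroup.closure {y, t} : Subgroup G) : Set G)) := by
  obtain ⟨m, hm⟩ := hy2
  obtain ⟨n, hn⟩ := ht2
  have hN : ¬ 2 ∣ Nat.card N := hodd.not_two_dvd_nat
  have hy : IsPGroup 2 (Subgroup.zpowers y) := .of_card (n := m) (by rw [Nat.card_zpowers, hm])
  have ht : IsPGroup 2 (Subgroup.zpowers t) := .of_card (n := n) (by rw [Nat.card_zpowers, hn])
  refine ⟨hy.factorization_card_conjugatesOf_mk' N hN, ?_⟩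
  have hconj : t * y * t⁻¹ = y⁻¹ := by
    rw [mul_assoc, inv_mul_eq_iff_eq_mul] at hinv
    rw [mul_inv_eq_iff_eq_mul, eq_inv_mul_iff_mul_eq, ← mul_assoc, hinv, inv_mul_cancel_right]
  have hnorm : Subgroup.zpowers t ≤ Subgroup.normalizer (Subgroup.zpowers y : Set G) := by
    rw [Subgroup.zpowers_le, Subgroup.mem_normalizer_iff_map_conj_eq, MonoidHom.map_zpowers,
      MonoidHom.coe_coe, MulAut.conj_apply, hconj, Subgroup.zpowers_inv]
  have hS : IsPGroup 2 (Subgroup.closure {y, t} : Subgroup G) := by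
    rw [Set.insert_eq, Subgroup.closure_union, ← Subgroup.zpowers_eq_closure,
      ← Subgroup.zpowers_eq_closure]
    exact hy.to_sup_of_normal_left' ht hnorm
  rw [← hS.centralizer_map_mk' N hN, MonoidHom.map_closure, Set.image_pair]
end

section
/- Let G be a finite group and let b ≥ 0 be an integer such that for every real element x of G not lying in the center Z(G), the 2-part of |C_G(x)| equals 2^b. Let N be a normal subgroup of G of odd order, write Ḡ = G/N, and let T̄ be the image in Ḡ of a subgroup T of G containing N. If x̄ is a real involution of T̄ not lying in the center Z(T̄), then the centralizer C_Ḡ(x̄) has a normal Sylow 2-subgroup. -/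
open Subgroup

/-- If `f : H → Q` is surjective with kernel a 2-group, an element of odd prime order `p` of `Q`
which generates a normal subgroup and is inverted by `s` gives rise to a nontrivial element
of odd order of `H` which is inverted in `H`. -/
theorem exists_inverted_of_surjective_of_normal {H Q : Type*} [Group H] [Finite H] [Group Q]
    (f : H →* Q) (hf : Function.Surjective f) (hker : IsPGroup 2 f.ker) {p : ℕ} (hp : p.Prime)
    (hp2 : p ≠ 2) {y s : Q} (hy : orderOf y = p) (hn : (zpowers y).Normal)
    (hs : s * y * s⁻¹ = y⁻¹) :
    ∃ z n : H, z ≠ 1 ∧ Odd (orderOf z) ∧ n * z * n⁻¹ = z⁻¹ := by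
  have : Fact p.Prime := ⟨hp⟩
  set K := (zpowers y).comap f with hK
  have hKn : K.Normal := hn.comap f
  obtain ⟨g, hg⟩ := hf y
  have hgK : g ∈ K := by rw [hK, mem_comap, hg]; exact mem_zpowers y
  have hpK : p ∣ Nat.card K := by
    refine ((hy ▸ hg ▸ orderOf_map_dvd f g : p ∣ orderOf g)).trans ?_
    rw [← Subgroup.orderOf_mk g hgK]
    exact orderOf_dvd_natCard _
  obtain ⟨z, hz⟩ := exists_prime_orderOf_dvd_card' p hpK
  have hzp : IsPGroup p (zpowers z) :=
    IsPGroup.of_card (n := 1) (by rw [Nat.card_zpowers, hz, pow_one])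
  obtain ⟨U, hU⟩ := hzp.exists_le_sylow
  obtain ⟨s₀, hs₀⟩ := hf s
  have htop : s₀ ∈ normalizer (U.map K.subtype) ⊔ K := by
    rw [U.normalizer_sup_eq_top]; trivial
  obtain ⟨n, hnU, k, hk, hnk⟩ := Subgroup.mem_sup_of_normal_right.1 htop
  have hUp : IsPGroup p (U.map K.subtype) := U.isPGroup'.map _
  have hzU : (z : H) ∈ U.map K.subtype := ⟨z, hU (mem_zpowers z), rfl⟩
  have hnz := (mem_normalizer_iff.1 hnU z).1 hzU
  have hdisj := IsPGroup.disjoint_of_ne p 2 hp2 _ _ hUp hker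
  obtain ⟨i, hi⟩ := mem_zpowers_iff.1 (mem_comap.1 z.2)
  obtain ⟨j, hj⟩ := mem_zpowers_iff.1 (mem_comap.1 hk)
  have hfn : f n = s * y ^ (-j) := by
    rw [← hs₀, ← hnk, map_mul, ← hj]; group
  have hzo : orderOf (z : H) = p := by rw [Subgroup.orderOf_coe, hz]
  refine ⟨z, n, fun h1 => ?_, ?_, ?_⟩
  · rw [h1, orderOf_one] at hzo
    exact hp.one_lt.ne hzo
  · rw [hzo]; exact hp.odd_of_ne_two hp2
  · rw [← mul_eq_one_iff_eq_inv, ← mem_bot, ← hdisj.eq_bot]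
    refine ⟨mul_mem hnz hzU, ?_⟩
    have h2 : f n * f z * (f n)⁻¹ = (s * y * s⁻¹) ^ i := by
      rw [hfn, ← hi, conj_zpow]; group
    change f (n * z * n⁻¹ * z) = 1
    rw [map_mul, map_mul, map_mul, map_inv, h2, hs, ← hi, inv_zpow, inv_mul_cancel]

/-- If `f : H → Q` is surjective with kernel a 2-group, an inverted element of odd prime order
of `Q` gives rise to an inverted nontrivial element of odd order of `H`. -/
theorem exists_inverted_of_surjective {H Q : Type*} [Group H] [Finite H] [Group Q]
    (f : H →* Q) (hf : Function.Surjective f) (hker : IsPGroup 2 f.ker) {p : ℕ} (hp : p.Prime)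
    (hp2 : p ≠ 2) {y s : Q} (hy : orderOf y = p) (hs : s * y * s⁻¹ = y⁻¹) :
    ∃ z n : H, z ≠ 1 ∧ Odd (orderOf z) ∧ n * z * n⁻¹ = z⁻¹ := by
  set M := normalizer (zpowers y : Set Q)
  have hyM : y ∈ M := le_normalizer (mem_zpowers y)
  have hsM : s ∈ M := by
    rw [mem_normalizer_iff_map_conj_eq, MonoidHom.map_zpowers]
    simp [hs]
  obtain ⟨z, n, hz, ho, hzn⟩ := exists_inverted_of_surjective_of_normal
    (f.subgroupComap M) (f.subgroupComap_surjective_of_surjective M hf) (fun ⟨g, hg⟩ => by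
      obtain ⟨k, hk⟩ := hker ⟨g, congrArg Subtype.val hg⟩
      have hk' : (g : H) ^ 2 ^ k = 1 := congrArg Subtype.val hk
      exact ⟨k, Subtype.ext (Subtype.ext hk')⟩) hp hp2
    (y := ⟨y, hyM⟩) (s := ⟨s, hsM⟩) (by rw [Subgroup.orderOf_mk, hy])
    (by
      have : zpowers (⟨y, hyM⟩ : M) = (zpowers y).subgroupOf M := by
        ext ⟨g, hg⟩
        simp [mem_zpowers_iff, mem_subgroupOf, Subtype.ext_iff]
      rw [this]
      exact normal_in_normalizer)
    (Subtype.ext hs)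
  exact ⟨z, n, by simpa using hz, by simpa using ho, congrArg Subtype.val hzn⟩

/-- A proper subgroup `D` of a finite 2-group `P` is normalized by some `a ∈ P \ D` with
`a ^ 2 ∈ D`. -/
theorem exists_normalizing_sq_mem {C : Type*} [Group C] [Finite C] {D P : Subgroup C}
    (hP : IsPGroup 2 P) (hDP : D < P) :
    ∃ a ∈ P, a ∉ D ∧ a ∈ normalizer (D : Set C) ∧ a ^ 2 ∈ D := by
  have : Fact (Nat.Prime 2) := ⟨Nat.prime_two⟩
  have := hP.isNilpotent
  have hlt : D.subgroupOf P < ⊤ := by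
    rw [lt_top_iff_ne_top, Ne, subgroupOf_eq_top]
    exact hDP.not_ge
  obtain ⟨⟨a, haP⟩, haN, haD⟩ :=
    SetLike.exists_of_lt (Group.normalizerCondition_of_isNilpotent (G := P) _ hlt)
  have haN' : a ∈ normalizer (D : Set C) := by
    rw [mem_normalizer_iff]
    intro h
    have hconj : a * h * a⁻¹ ∈ P ↔ h ∈ P := by
      rw [mul_mem_cancel_right (inv_mem haP), mul_mem_cancel_left haP]
    by_cases hh : h ∈ P
    · exact mem_normalizer_iff.1 haN ⟨h, hh⟩
    · exact ⟨fun h1 => (hh (hDP.le h1)).elim, fun h1 => (hh (hconj.1 (hDP.le h1))).elim⟩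
  have hex : ∃ k, a ^ 2 ^ k ∈ D := by
    obtain ⟨k, hk⟩ := hP ⟨a, haP⟩
    refine ⟨k, ?_⟩
    have : a ^ 2 ^ k = 1 := congrArg Subtype.val hk
    rw [this]; exact one_mem D
  classical
  obtain ⟨m, hm⟩ : ∃ m, Nat.find hex = m + 1 := Nat.exists_eq_succ_of_ne_zero fun h0 => haD <| by
    have := Nat.find_spec hex
    rw [h0, pow_zero, pow_one] at this
    exact this
  refine ⟨a ^ 2 ^ m, pow_mem haP _, Nat.find_min hex (by omega), pow_mem haN' _, ?_⟩
  rw [← pow_mul, ← pow_succ, ← hm]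
  exact Nat.find_spec hex

/-- Two elements of square `1` whose product has 2-power order lie in a common 2-subgroup. -/
theorem exists_isPGroup_two_of_involutions {Q : Type*} [Group Q] {s t : Q} (hs : s ^ 2 = 1)
    (ht : t ^ 2 = 1) (hst : ∃ k, (s * t) ^ 2 ^ k = 1) :
    ∃ E : Subgroup Q, IsPGroup 2 E ∧ s ∈ E ∧ t ∈ E := by
  have hz : ∀ g : Q, (∃ k, g ^ 2 ^ k = 1) → IsPGroup 2 (zpowers g) := by
    rintro g ⟨k, hk⟩ ⟨x, hx⟩
    obtain ⟨i, rfl⟩ := mem_zpowers_iff.1 hx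
    refine ⟨k, Subtype.ext ?_⟩
    simp only [SubmonoidClass.coe_pow, OneMemClass.coe_one]
    rw [← zpow_natCast, ← zpow_mul, mul_comm, zpow_mul, zpow_natCast, hk, one_zpow]
  have hs' : s⁻¹ = s := by rw [inv_eq_iff_mul_eq_one, ← pow_two, hs]
  have ht' : t⁻¹ = t := by rw [inv_eq_iff_mul_eq_one, ← pow_two, ht]
  have hle : zpowers s ≤ normalizer (zpowers (s * t) : Set Q) := by
    rw [zpowers_le, mem_normalizer_iff_map_conj_eq, MonoidHom.map_zpowers]
    have : s * (s * t) * s⁻¹ = (s * t)⁻¹ := by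
      rw [mul_inv_rev, ht', hs', ← mul_assoc, ← pow_two, hs, one_mul]
    simp only [MonoidHom.coe_coe, MulAut.conj_apply, this, zpowers_inv]
  have hsE : s ∈ zpowers s ⊔ zpowers (s * t) := le_sup_left (a := zpowers s) (mem_zpowers s)
  refine ⟨zpowers s ⊔ zpowers (s * t),
    (hz s ⟨1, by simpa using hs⟩).to_sup_of_normal_right' (hz _ hst) hle, hsE, ?_⟩
  exact (mul_mem_cancel_left hsE).1
    (le_sup_right (a := zpowers s) (mem_zpowers (s * t)))

/-- A finite group without nontrivial inverted elements of odd order is 2-closed. -/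
theorem subsingleton_sylow_two {C : Type*} [Group C] [Finite C]
    (hC : ∀ z n : C, Odd (orderOf z) → n * z * n⁻¹ = z⁻¹ → z = 1) :
    Subsingleton (Sylow 2 C) := by
  have : Fact (Nat.Prime 2) := ⟨Nat.prime_two⟩
  by_contra hsub
  rw [not_subsingleton_iff_nontrivial] at hsub
  obtain ⟨P₀, Q₀, hne₀⟩ := exists_pair_ne (Sylow 2 C)
  have : Nonempty {R : Sylow 2 C × Sylow 2 C // R.1 ≠ R.2} := ⟨⟨(P₀, Q₀), hne₀⟩⟩
  obtain ⟨⟨⟨P, Q⟩, hne⟩, hmax⟩ := Finite.exists_max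
    fun R : {R : Sylow 2 C × Sylow 2 C // R.1 ≠ R.2} =>
      Nat.card ((R.1.1 : Subgroup C) ⊓ R.1.2 : Subgroup C)
  simp only at hne hmax
  set D : Subgroup C := (P : Subgroup C) ⊓ Q with hD
  have hDP : D < P := by
    refine inf_le_left.lt_of_ne fun h => hne ?_
    exact (Sylow.ext (P.is_maximal' Q.isPGroup' (inf_eq_left.1 h))).symm
  have hDQ : D < Q := by
    refine inf_le_right.lt_of_ne fun h => hne ?_
    exact Sylow.ext (Q.is_maximal' P.isPGroup' (inf_eq_right.1 h))
  obtain ⟨a, haP, haD, haN, ha2⟩ := exists_normalizing_sq_mem P.isPGroup' hDP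
  obtain ⟨b, hbQ, hbD, hbN, hb2⟩ := exists_normalizing_sq_mem Q.isPGroup' hDQ
  set H := normalizer (D : Set C)
  set D' := D.subgroupOf H
  have hD'n : D'.Normal := normal_in_normalizer
  have hD'p : IsPGroup 2 D' := (P.isPGroup'.to_le hDP.le).comap_subtype
  set f := QuotientGroup.mk' D'
  have hfker : IsPGroup 2 f.ker := by rw [QuotientGroup.ker_mk']; exact hD'p
  set s := f ⟨a, haN⟩
  set t := f ⟨b, hbN⟩
  have hs : s ^ 2 = 1 := by
    rw [← map_pow]; exact (QuotientGroup.eq_one_iff _).2 ha2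
  have ht : t ^ 2 = 1 := by
    rw [← map_pow]; exact (QuotientGroup.eq_one_iff _).2 hb2
  by_cases hst : ∃ k, (s * t) ^ 2 ^ k = 1
  · obtain ⟨E, hE, hsE, htE⟩ := exists_isPGroup_two_of_involutions hs ht hst
    obtain ⟨R, hR⟩ := ((hE.comap_of_ker_isPGroup f hfker).map H.subtype).exists_le_sylow
    have haR : a ∈ R := hR ⟨⟨a, haN⟩, hsE, rfl⟩
    have hbR : b ∈ R := hR ⟨⟨b, hbN⟩, htE, rfl⟩
    have hDR : D ≤ R := fun d hd => hR ⟨⟨d, le_normalizer hd⟩, by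
      have : f ⟨d, le_normalizer hd⟩ = 1 := (QuotientGroup.eq_one_iff _).2 hd
      simp [this], rfl⟩
    have key : ∀ (S : Sylow 2 C) (c : C), D ≤ S → c ∈ S → c ∈ R → c ∉ D → S = R := by
      intro S c hDS hcS hcR hcD
      by_contra hSR
      have h1 := hmax ⟨(S, R), hSR⟩
      have h2 : D = (S : Subgroup C) ⊓ R := Subgroup.eq_of_le_of_card_ge (le_inf hDS hDR) h1
      exact hcD (h2 ▸ ⟨hcS, hcR⟩)
    exact hne ((key P a hDP.le haP haR haD).trans (key Q b hDQ.le hbQ hbR hbD).symm)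
  · obtain ⟨p, hp, hpd, hp2⟩ : ∃ p, p.Prime ∧ p ∣ orderOf (s * t) ∧ p ≠ 2 := by
      by_contra! hcon
      have h2 := Nat.eq_prime_pow_of_unique_prime_dvd (orderOf_pos (s * t)).ne'
        (fun {d} hd hdd => hcon d hd hdd)
      exact hst ⟨_, orderOf_dvd_iff_pow_eq_one.1 h2.dvd⟩
    have hs' : s⁻¹ = s := by rw [inv_eq_iff_mul_eq_one, ← pow_two, hs]
    have ht' : t⁻¹ = t := by rw [inv_eq_iff_mul_eq_one, ← pow_two, ht]
    obtain ⟨z, n, hz, ho, hzn⟩ := exists_inverted_of_surjective f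
      (QuotientGroup.mk'_surjective D') hfker hp hp2
      (y := (s * t) ^ (orderOf (s * t) / p)) (s := s)
      (orderOf_pow_orderOf_div (orderOf_pos _).ne' hpd) (by
        rw [← conj_pow, ← inv_pow, mul_inv_rev, ht', hs', ← mul_assoc, ← pow_two, hs, one_mul])
    exact hz (Subtype.ext (hC z n (by simpa using ho) (congrArg Subtype.val hzn)))

/-- If a noncentral involution `x` and the real elements `x * z` with `z` of odd order have
centralizers with the same 2-part, then no nontrivial element of odd order is inverted
in `C_G(x)`. -/
theorem eq_one_of_inverted_in_centralizer {G : Type*} [Group G] [Finite G] {b : ℕ}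
    (h : ∀ x : G, IsConj x x⁻¹ → x ∉ center G →
      (Nat.card (centralizer {x})).factorization 2 = b)
    {x : G} (hx2 : x ^ 2 = 1) (hxc : x ∉ center G) {z n : G} (hzx : Commute z x)
    (hnx : Commute n x) (hz : Odd (orderOf z)) (hn : n * z * n⁻¹ = z⁻¹) : z = 1 := by
  by_contra hz1
  have hx' : x⁻¹ = x := by rw [inv_eq_iff_mul_eq_one, ← pow_two, hx2]
  have hzz : z⁻¹ ≠ z := fun hzz => hz1 <| by
    have : z ^ 2 = 1 := by rw [pow_two, ← inv_eq_iff_mul_eq_one, hzz]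
    rw [← orderOf_eq_one_iff]
    exact Nat.Coprime.eq_one_of_dvd (hz.coprime_two_right) (orderOf_dvd_of_pow_eq_one this)
  have hpow : (x * z) ^ orderOf z = x := by
    rw [hzx.symm.mul_pow, pow_orderOf_eq_one, mul_one]
    obtain ⟨k, hk⟩ := hz
    rw [hk, pow_succ, pow_mul, hx2, one_pow, one_mul]
  have hmem : ∀ g : G, g ∈ centralizer {x * z} ↔ Commute g x ∧ Commute g z := by
    intro g
    rw [mem_centralizer_singleton_iff]
    constructor
    · intro hg
      have hgx : Commute g x := hpow ▸ Commute.pow_right (show Commute g (x * z) from hg) _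
      refine ⟨hgx, ?_⟩
      have := hgx.inv_right.mul_right (show Commute g (x * z) from hg)
      rwa [inv_mul_cancel_left] at this
    · rintro ⟨h1, h2⟩
      exact h1.mul_right h2
  have hc1 := h x (by rw [hx']) hxc
  have hc2 := h (x * z) (isConj_iff.2 ⟨n, by
      rw [mul_inv_rev, hx', ← hn, ← mul_assoc, hnx.eq]
      have h1 : Commute (n * z * n⁻¹) x := (hnx.mul_left hzx).mul_left hnx.inv_left
      rw [h1.eq]; group⟩)
    (fun hcen => hxc (hpow ▸ pow_mem hcen _))
  let M : Subgroup G :=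
    { carrier := {g | Commute g x ∧ (g * z * g⁻¹ = z ∨ g * z * g⁻¹ = z⁻¹)}
      one_mem' := ⟨Commute.one_left x, by simp⟩
      mul_mem' := by
        rintro g k ⟨hg, hg'⟩ ⟨hk, hk'⟩
        refine ⟨hg.mul_left hk, ?_⟩
        have e : g * k * z * (g * k)⁻¹ = g * (k * z * k⁻¹) * g⁻¹ := by group
        rw [e]
        rcases hk' with hk' | hk' <;> rw [hk']
        · exact hg'
        · rw [← conj_inv]
          rcases hg' with hg' | hg' <;> rw [hg'] <;> simp
      inv_mem' := by
        rintro g ⟨hg, hg'⟩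
        refine ⟨hg.inv_left, ?_⟩
        rcases hg' with hg' | hg'
        · left; nth_rw 1 [← hg']; group
        · right
          have h1 : z = g * z⁻¹ * g⁻¹ := by rw [← conj_inv, hg', inv_inv]
          nth_rw 1 [h1]; group }
  have hEM : centralizer {x * z} ≤ M := fun g hg =>
    ⟨((hmem g).1 hg).1, Or.inl (by rw [((hmem g).1 hg).2.eq, mul_inv_cancel_right])⟩
  have hMC : M ≤ centralizer {x} := fun g hg => mem_centralizer_singleton_iff.2 hg.1
  have hEmem : ∀ g ∈ M, g ∈ centralizer {x * z} ↔ g * z * g⁻¹ = z := fun g hg => by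
    rw [hmem, mul_inv_eq_iff_eq_mul]
    exact ⟨fun hh => hh.2, fun hh => ⟨hg.1, hh⟩⟩
  have hnM : n ∈ M := ⟨hnx, Or.inr hn⟩
  have hidx : ((centralizer {x * z}).subgroupOf M).index = 2 := by
    rw [index_eq_two_iff]
    refine ⟨⟨n, hnM⟩, fun ⟨g, hg⟩ => ?_⟩
    rw [mem_subgroupOf, mem_subgroupOf]
    change Xor (g * n ∈ _) (g ∈ _)
    rw [hEmem g hg, hEmem _ (mul_mem hg hnM)]
    have e : g * n * z * (g * n)⁻¹ = (g * z * g⁻¹)⁻¹ := by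
      rw [conj_inv, ← hn]; group
    rw [e]
    rcases hg.2 with hg' | hg' <;> rw [hg'] <;> simp [Xor, hzz]
  have hcard : Nat.card (centralizer {x * z}) * 2 ∣ Nat.card (centralizer {x}) := by
    have h1 := card_mul_index ((centralizer {x * z}).subgroupOf M)
    rw [hidx, Nat.card_congr (subgroupOfEquivOfLe hEM).toEquiv] at h1
    rw [h1]
    exact card_dvd_of_le hMC
  have hle := (Nat.factorization_le_iff_dvd (by simp [Nat.card_pos.ne'])
    Nat.card_pos.ne').2 hcard 2
  rw [Nat.factorization_mul Nat.card_pos.ne' two_ne_zero, Finsupp.add_apply, hc1, hc2,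
    Nat.prime_two.factorization_self] at hle
  omega

/-- Modulo a normal subgroup `N` of odd order, elements of order 2 lift to elements of
square `1`. -/
theorem exists_sq_eq_one_lift {G : Type*} [Group G] [Finite G] {N : Subgroup G} [N.Normal]
    (hodd : Odd (Nat.card N)) {x : G ⧸ N} (hx : x ^ 2 = 1) :
    ∃ g : G, g ^ 2 = 1 ∧ (g : G ⧸ N) = x := by
  obtain ⟨g, rfl⟩ := QuotientGroup.mk_surjective x
  have hg : g ^ 2 ∈ N := (QuotientGroup.eq_one_iff _).1 hx
  refine ⟨g ^ Nat.card N, ?_, ?_⟩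
  · have : (⟨g ^ 2, hg⟩ : N) ^ Nat.card N = 1 := pow_card_eq_one'
    rw [← pow_mul, mul_comm, pow_mul]
    exact congrArg Subtype.val this
  · obtain ⟨k, hk⟩ := hodd
    rw [QuotientGroup.mk_pow, hk, pow_succ, pow_mul, hx, one_pow, one_mul]

/-- Modulo a normal subgroup `N` of odd order, the centralizer of the image of an element `x` of
square `1` is covered by the centralizer of `x`. -/
theorem exists_commute_lift {G : Type*} [Group G] [Finite G] {N : Subgroup G} [N.Normal]
    (hodd : Odd (Nat.card N)) {x : G} (hx : x ^ 2 = 1) {y : G ⧸ N} (hy : Commute y x) :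
    ∃ g : G, Commute g x ∧ (g : G ⧸ N) = y := by
  obtain ⟨g, rfl⟩ := QuotientGroup.mk_surjective y
  have hx' : x⁻¹ = x := by rw [inv_eq_iff_mul_eq_one, ← pow_two, hx]
  set v := g * x * g⁻¹ with hv
  have hv' : v⁻¹ = v := by rw [hv, conj_inv, hx']
  have hn : x * v ∈ N := by
    rw [← QuotientGroup.eq_one_iff]
    have h1 : (g : G ⧸ N) * x * (g : G ⧸ N)⁻¹ = x := by rw [hy.eq, mul_inv_cancel_right]
    simp only [hv, QuotientGroup.mk_mul, QuotientGroup.mk_inv, h1]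
    rw [← QuotientGroup.mk_mul, ← pow_two, hx, QuotientGroup.mk_one]
  obtain ⟨k, hk⟩ := hodd
  have hnk : (x * v) ^ (2 * k + 1) = 1 := by
    have : (⟨x * v, hn⟩ : N) ^ Nat.card N = 1 := pow_card_eq_one'
    rw [← hk]
    exact congrArg Subtype.val this
  set w := (x * v) ^ (k + 1) with hw
  have hww : w * w = x * v := by
    rw [hw, ← pow_add, show k + 1 + (k + 1) = (2 * k + 1) + 1 by ring, pow_succ, hnk, one_mul]
  have hxw : x * w * x⁻¹ = w⁻¹ := by
    rw [hw, ← conj_pow, ← inv_pow, mul_inv_rev, hx', hv', ← mul_assoc, ← pow_two, hx, one_mul]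
  have hwv : w * v * w⁻¹ = x := by
    have h1 : w⁻¹ * x * w = v := by
      rw [← hxw, inv_mul_cancel_right, mul_assoc, hww, ← mul_assoc, ← pow_two, hx, one_mul]
    rw [← h1]; group
  refine ⟨w * g, ?_, ?_⟩
  · have : w * g * x * (w * g)⁻¹ = x := Eq.trans (by rw [hv]; group) hwv
    exact mul_inv_eq_iff_eq_mul.1 this
  · have : (w : G ⧸ N) = 1 := (QuotientGroup.eq_one_iff _).2 (pow_mem hn _)
    rw [QuotientGroup.mk_mul, this, one_mul]

/-- Suppose every real element `x ∉ Z(G)` of a finite group `G` has centralizer whose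
order has 2-part `2 ^ b`. Let `N` be a normal subgroup of odd order, `Ḡ = G/N`, and let
`T̄` be the image in `Ḡ` of a subgroup `T ≥ N`. If `x̄` is a real involution of `T̄` not
lying in `Z(T̄)`, then `C_Ḡ(x̄)` has a normal Sylow 2-subgroup. -/
theorem stmt_16 {G : Type*} [Group G] [Finite G] (b : ℕ)
    (h : ∀ x : G, IsConj x x⁻¹ → x ∉ Subgroup.center G →
      (Nat.card (Subgroup.centralizer {x})).factorization 2 = b)
    (N : Subgroup G) [N.Normal] (hodd : Odd (Nat.card N))
    (T : Subgroup G) (hNT : N ≤ T)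
    (x : G ⧸ N) (hxT : x ∈ Subgroup.map (QuotientGroup.mk' N) T)
    (hx2 : orderOf x = 2)
    (hreal : IsConj (⟨x, hxT⟩ : Subgroup.map (QuotientGroup.mk' N) T)
      (⟨x, hxT⟩ : Subgroup.map (QuotientGroup.mk' N) T)⁻¹)
    (hxc : (⟨x, hxT⟩ : Subgroup.map (QuotientGroup.mk' N) T) ∉
      Subgroup.center (Subgroup.map (QuotientGroup.mk' N) T)) :
    ∃ P : Sylow 2 (Subgroup.centralizer {x}),
      (P : Subgroup (Subgroup.centralizer {x})).Normal := by
  have : Fact (Nat.Prime 2) := ⟨Nat.prime_two⟩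
  obtain ⟨g, hg2, rfl⟩ := exists_sq_eq_one_lift hodd (hx2 ▸ pow_orderOf_eq_one x)
  have hgc : g ∉ center G := fun hg => hxc <| mem_center_iff.2 fun ⟨y, _⟩ => Subtype.ext <| by
    obtain ⟨k, rfl⟩ := QuotientGroup.mk_surjective y
    exact congrArg (QuotientGroup.mk (s := N)) (mem_center_iff.1 hg k)
  let f : centralizer {g} →* centralizer {(g : G ⧸ N)} :=
    ((QuotientGroup.mk' N).comp (centralizer {g}).subtype).codRestrict _ fun k =>
      mem_centralizer_singleton_iff.2
        (congrArg (QuotientGroup.mk (s := N)) (mem_centralizer_singleton_iff.1 k.2))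
  have hf : Function.Surjective f := by
    rintro ⟨y, hy⟩
    obtain ⟨k, hk, rfl⟩ := exists_commute_lift hodd hg2 (mem_centralizer_singleton_iff.1 hy)
    exact ⟨⟨k, mem_centralizer_singleton_iff.2 hk⟩, rfl⟩
  have hsub : Subsingleton (Sylow 2 (centralizer {g})) := subsingleton_sylow_two
    fun ⟨z, hz⟩ ⟨n, hn⟩ hzo hzn => Subtype.ext <|
      eq_one_of_inverted_in_centralizer h hg2 hgc (mem_centralizer_singleton_iff.1 hz)
        (mem_centralizer_singleton_iff.1 hn) (by rwa [Subgroup.orderOf_mk] at hzo)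
        (congrArg Subtype.val hzn)
  have : Subsingleton (Sylow 2 (centralizer {(g : G ⧸ N)})) :=
    (Sylow.mapSurjective_surjective hf 2).subsingleton
  obtain ⟨P⟩ : Nonempty (Sylow 2 (centralizer {(g : G ⧸ N)})) := inferInstance
  exact ⟨P, P.normal_of_subsingleton⟩
end
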